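/- Let ρ and σ be coprime integers with σ ≠ 0 and |ρ| > |σ|, and set q = ρ/σ (regarded as a complex number, so |q| > 1). Let α be a nonzero complex number and let μ = Σ_{n=0}^∞ α^n · q^{−n(n+1)/2} (this is the value F_q(α;0) = Σ_{n=0}^∞ α^n / ∏_{j=1}^n q^j of the Tschakaloff-type series). If log|ρ| > (126π² / (47π² − 72√3·L)) · log|σ|, where L = Σ_{n=1}^∞ sin(2πn/3)/n², then there is no subfield K of ℂ that is a finite extension of ℚ of degree at most 2 containing both α and μ; in particular α and μ are not both rational and not both contained in a quadratic number field. -/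

import Mathlib

open scoped BigOperators

section Hankel

open Polynomial

variable {A : Type*} [CommRing A]

/-- The shift operator on sequences. -/
def seqShift (A : Type*) [CommRing A] : Module.End A (ℕ → A) where
  toFun w n := w (n + 1)
  map_add' _ _ := rfl
  map_smul' _ _ := rfl

theorem seqShift_pow_apply (k : ℕ) (w : ℕ → A) (n : ℕ) :
    (seqShift A ^ k) w n = w (n + k) := by
  induction k generalizing n with
  | zero => simp
  | succ k ih =>
    rw [pow_succ', Module.End.mul_apply]
    change (seqShift A ^ k) w (n + 1) = _
    rw [ih]; congr 1; ring

/-- Evaluation at `0` of the difference operator `P (seqShift A)` applied to `w`. -/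
noncomputable def seqFunctional (w : ℕ → A) : A[X] →ₗ[A] A where
  toFun P := aeval (seqShift A) P w 0
  map_add' P Q := by simp
  map_smul' r P := by simp

theorem seqFunctional_apply (w : ℕ → A) (P : A[X]) :
    seqFunctional w P = aeval (seqShift A) P w 0 := rfl

theorem seqFunctional_X_pow (w : ℕ → A) (k : ℕ) : seqFunctional w (X ^ k) = w k := by
  simp [seqFunctional_apply, seqShift_pow_apply]

theorem seqFunctional_mul_X_pow (w : ℕ → A) (P : A[X]) (k : ℕ) :
    seqFunctional w (P * X ^ k) = aeval (seqShift A) P w k := by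
  rw [mul_comm, seqFunctional_apply, map_mul, Module.End.mul_apply, map_pow, aeval_X,
    seqShift_pow_apply, zero_add]

theorem seqFunctional_C_mul (w : ℕ → A) (r : A) (P : A[X]) :
    seqFunctional w (C r * P) = r * seqFunctional w P := by
  rw [← smul_eq_C_mul, map_smul, smul_eq_mul]

theorem det_seqFunctional_mul (w : ℕ → A) (n : ℕ) (P Q : ℕ → A[X])
    (hP : ∀ i, (P i).Monic) (hP' : ∀ i, (P i).natDegree = i)
    (hQ : ∀ i, (Q i).Monic) (hQ' : ∀ i, (Q i).natDegree = i) :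
    (Matrix.of fun i j : Fin n => seqFunctional w (P i * Q j)).det =
      (Matrix.of fun i j : Fin n => w (i + j)).det := by
  have key : (Matrix.of fun i j : Fin n => seqFunctional w (P i * Q j)) =
      (Matrix.of fun i j : Fin n => (P j).coeff i).transpose *
        (Matrix.of fun i j : Fin n => w (i + j)) *
        (Matrix.of fun i j : Fin n => (Q j).coeff i) := by
    ext i j
    have h1 : ∀ (R : ℕ → A[X]) (_ : ∀ i, (R i).natDegree = i) (i : Fin n),
        R i = ∑ k : Fin n, C ((R i).coeff k) * X ^ (k : ℕ) := by
      intro R hR i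
      rw [Fin.sum_univ_eq_sum_range (fun k => C ((R i).coeff k) * X ^ k) n]
      exact as_sum_range_C_mul_X_pow' _ (by rw [hR]; exact i.2)
    rw [Matrix.of_apply, h1 P hP' i, h1 Q hQ' j, Finset.sum_mul_sum, map_sum]
    simp only [map_sum, Matrix.mul_apply, Matrix.transpose_apply, Matrix.of_apply,
      Finset.sum_mul]
    rw [Finset.sum_comm]
    refine Finset.sum_congr rfl fun k _ => Finset.sum_congr rfl fun l _ => ?_
    rw [show C ((P i).coeff l) * X ^ (l : ℕ) * (C ((Q j).coeff k) * X ^ (k : ℕ)) =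
      C ((P i).coeff l) * (C ((Q j).coeff k) * X ^ ((l : ℕ) + k)) by ring,
      seqFunctional_C_mul, seqFunctional_C_mul, seqFunctional_X_pow]
    ring
  rw [key, Matrix.det_mul, Matrix.det_mul, Matrix.det_transpose,
    Matrix.det_matrixOfPolynomials _ (fun i => hP' i) (fun i => hP i),
    Matrix.det_matrixOfPolynomials _ (fun i => hQ' i) (fun i => hQ i), one_mul, mul_one]

theorem pow_dvd_det {n : ℕ} (x : A) (M : Matrix (Fin n) (Fin n) A) (f : Fin n → Fin n → ℕ)
    (hM : ∀ i j, x ^ f i j ∣ M i j) (e : ℕ) (he : ∀ π : Equiv.Perm (Fin n), e ≤ ∑ i, f (π i) i) :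
    x ^ e ∣ M.det := by
  rw [Matrix.det_apply]
  refine Finset.dvd_sum fun π _ => ?_
  refine Dvd.dvd.trans (pow_dvd_pow x (he π)) ?_
  rw [← Finset.prod_pow_eq_pow_sum]
  exact (Finset.prod_dvd_prod_of_dvd _ _ fun i _ => hM (π i) i).trans
    (by rw [Units.smul_def, zsmul_eq_mul]; exact Dvd.intro_left _ rfl)

theorem natDegree_det_le {R : Type*} [CommRing R] {n : ℕ} (M : Matrix (Fin n) (Fin n) R[X])
    (g h : Fin n → ℕ) (hM : ∀ i j, (M i j).natDegree ≤ g i + h j) :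
    M.det.natDegree ≤ ∑ i, (g i + h i) := by
  rw [Matrix.det_apply]
  refine natDegree_sum_le_of_forall_le _ _ fun π _ => ?_
  rw [Units.smul_def, zsmul_eq_mul]
  refine natDegree_mul_le.trans ?_
  rw [natDegree_intCast, zero_add]
  refine (natDegree_prod_le _ _).trans ((Finset.sum_le_sum fun i _ => hM (π i) i).trans ?_)
  rw [Finset.sum_add_distrib, Finset.sum_add_distrib, Equiv.sum_comp π g]

theorem norm_det_le {n : ℕ} (M : Matrix (Fin n) (Fin n) ℂ) (g h : Fin n → ℝ)
    (hM : ∀ i j, ‖M i j‖ ≤ Real.exp (g i + h j)) :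
    ‖M.det‖ ≤ n.factorial * Real.exp (∑ i, (g i + h i)) := by
  rw [Matrix.det_apply]
  refine (norm_sum_le _ _).trans ?_
  have : ∀ π ∈ (Finset.univ : Finset (Equiv.Perm (Fin n))),
      ‖Equiv.Perm.sign π • ∏ i, M (π i) i‖ ≤ Real.exp (∑ i, (g i + h i)) := by
    intro π _
    rw [Units.smul_def, zsmul_eq_mul, norm_mul]
    have h1 : ‖(((Equiv.Perm.sign π : ℤˣ) : ℤ) : ℂ)‖ = 1 := by
      rcases Int.units_eq_one_or (Equiv.Perm.sign π) with h | h <;> simp [h]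
    rw [h1, one_mul, norm_prod]
    refine (Finset.prod_le_prod (fun i _ => norm_nonneg _) fun i _ => hM (π i) i).trans ?_
    rw [← Real.exp_sum, Finset.sum_add_distrib, Finset.sum_add_distrib, Equiv.sum_comp π g]
  refine (Finset.sum_le_card_nsmul _ _ _ this).trans ?_
  rw [Finset.card_univ, Fintype.card_perm, Fintype.card_fin, nsmul_eq_mul]

end Hankel

section Tschakaloff

open Polynomial

variable {A : Type*} [CommRing A]

/-- The sequence with `u 0 = b` and `u (n + 1) = x ^ (n + 1) * (d * u n - c * a ^ n)`. For
`c = d = 1` its terms are the numerators `x ^ (n (n + 1) / 2) * (b - ∑_{k < n} a ^ k / x ^ (k (k + 1) / 2))`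
of the remainders of the Tschakaloff series. -/
def tschSeq (x d c a b : A) : ℕ → A
  | 0 => b
  | n + 1 => x ^ (n + 1) * (d * tschSeq x d c a b n - c * a ^ n)

variable (x d c a b : A)

theorem map_tschSeq {B : Type*} [CommRing B] (f : A →+* B) (n : ℕ) :
    f (tschSeq x d c a b n) = tschSeq (f x) (f d) (f c) (f a) (f b) n := by
  induction n with
  | zero => rfl
  | succ n ih => simp [tschSeq, ih]

/-- The operator `∏_{m = 1}^j (S - a x ^ m)`. -/
noncomputable def geomOp (j : ℕ) : A[X] := ∏ m ∈ Finset.range j, (X - C (a * x ^ (m + 1)))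

theorem geomOp_monic (j : ℕ) : (geomOp x a j).Monic :=
  monic_prod_of_monic _ _ fun _ _ => monic_X_sub_C _

theorem geomOp_natDegree [Nontrivial A] (j : ℕ) : (geomOp x a j).natDegree = j := by
  rw [geomOp, natDegree_prod_of_monic _ _ fun _ _ => monic_X_sub_C _]
  simp only [natDegree_X_sub_C, Finset.sum_const, Finset.card_range, smul_eq_mul, mul_one]

theorem geomOp_succ_apply (w : ℕ → A) (j n : ℕ) :
    aeval (seqShift A) (geomOp x a (j + 1)) w n =
      aeval (seqShift A) (geomOp x a j) w (n + 1) -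
        a * x ^ (j + 1) * aeval (seqShift A) (geomOp x a j) w n := by
  rw [geomOp, Finset.prod_range_succ, mul_comm, map_mul, Module.End.mul_apply, ← geomOp, map_sub,
    aeval_X, aeval_C, LinearMap.sub_apply, Module.algebraMap_end_apply]
  rfl

theorem geomOp_tschSeq_succ (j n : ℕ) :
    aeval (seqShift A) (geomOp x a (j + 1)) (tschSeq x d c a b) (n + 1) =
      d * x ^ (n + j + 2) * (aeval (seqShift A) (geomOp x a j) (tschSeq x d c a b) (n + 1) -
        a * aeval (seqShift A) (geomOp x a j) (tschSeq x d c a b) n) := by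
  induction j generalizing n with
  | zero =>
    rw [geomOp_succ_apply]
    simp only [geomOp, Finset.range_zero, Finset.prod_empty, map_one, Module.End.one_apply]
    rw [tschSeq, tschSeq]
    ring
  | succ j ih =>
    have h1 := geomOp_succ_apply x a (tschSeq x d c a b) (j + 1) (n + 1)
    have h2 := geomOp_succ_apply x a (tschSeq x d c a b) j (n + 1)
    have h3 := geomOp_succ_apply x a (tschSeq x d c a b) j n
    rw [h1, ih (n + 1), h2, h3]
    have h4 := ih n
    rw [h2] at h4
    linear_combination -(a * x ^ (j + 1 + 1)) * h4

/-- A lower bound for the order at `x = 0` of `∏_{m = 1}^j (S - a x ^ m) u` at `i`. -/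
def geomOrd (i j : ℕ) : ℕ := if j ≤ i then i * j else (i + j) ^ 2 / 4

theorem add_two_sq_div_four (k : ℕ) : (k + 2) ^ 2 / 4 = k ^ 2 / 4 + (k + 1) := by
  rw [show (k + 2) ^ 2 = k ^ 2 + 4 * (k + 1) by ring, Nat.add_mul_div_left _ _ (by norm_num)]

theorem geomOrd_succ_le (i j : ℕ) :
    geomOrd (i + 1) (j + 1) ≤ i + j + 2 + geomOrd (i + 1) j ∧
      geomOrd (i + 1) (j + 1) ≤ i + j + 2 + geomOrd i j := by
  have hle : ∀ i j, j ≤ i → geomOrd i j = i * j := fun i j h => if_pos h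
  have hlt : ∀ i j, i < j → geomOrd i j = (i + j) ^ 2 / 4 := fun i j h => if_neg (by omega)
  rcases le_or_gt j i with h | h
  · rw [hle (i + 1) (j + 1) (by omega), hle (i + 1) j (by omega), hle i j h]
    constructor <;> nlinarith
  · rw [hlt (i + 1) (j + 1) (by omega), hlt i j h, show i + 1 + (j + 1) = (i + j) + 2 by ring,
      add_two_sq_div_four]
    refine ⟨?_, by omega⟩
    rcases Nat.lt_or_ge (i + 1) j with h' | h'
    · rw [hlt _ _ h']
      have : (i + j) ^ 2 / 4 ≤ (i + 1 + j) ^ 2 / 4 := Nat.div_le_div_right (by gcongr; omega)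
      omega
    · obtain rfl : j = i + 1 := by omega
      rw [hle _ _ le_rfl]
      have : (i + (i + 1)) ^ 2 / 4 ≤ (i + 1) * (i + 1) :=
        Nat.div_le_of_le_mul (by nlinarith)
      omega

theorem geomOrd_zero_le (j : ℕ) : geomOrd 0 (j + 2) ≤ j + 2 + geomOrd 1 j ∧
    geomOrd 0 (j + 2) ≤ j + 2 + geomOrd 0 j ∧ geomOrd 0 (j + 2) ≤ j + 2 + geomOrd 0 (j + 1) := by
  have h2 : geomOrd 0 (j + 2) = j ^ 2 / 4 + (j + 1) := by
    rw [geomOrd, if_neg (by omega), zero_add, add_two_sq_div_four]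
  have h0 : j ^ 2 / 4 ≤ geomOrd 0 j := by
    unfold geomOrd; split_ifs with h
    · have : j = 0 := by omega
      subst this; simp
    · simp
  have h1 : j ^ 2 / 4 ≤ geomOrd 1 j + 1 := by
    unfold geomOrd; split_ifs with h
    · have : j ^ 2 / 4 ≤ 1 := Nat.div_le_of_le_mul (by nlinarith)
      omega
    · have : j ^ 2 / 4 ≤ (1 + j) ^ 2 / 4 := Nat.div_le_div_right (by gcongr; omega)
      omega
  have h3 : j ^ 2 / 4 ≤ geomOrd 0 (j + 1) := by
    rw [geomOrd, if_neg (by omega)]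
    exact Nat.div_le_div_right (by gcongr; omega)
  omega

theorem pow_geomOrd_dvd (j i : ℕ) :
    x ^ geomOrd i j ∣ aeval (seqShift A) (geomOp x a j) (tschSeq x d c a b) i := by
  induction j using Nat.strong_induction_on generalizing i with
  | _ j ih =>
    have step : ∀ j' i', j' + 1 ≤ j → ∀ e, e ≤ i' + j' + 2 + geomOrd (i' + 1) j' →
        e ≤ i' + j' + 2 + geomOrd i' j' →
        x ^ e ∣ aeval (seqShift A) (geomOp x a (j' + 1)) (tschSeq x d c a b) (i' + 1) := by
      intro j' i' hj e h1 h2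
      rw [geomOp_tschSeq_succ, mul_sub]
      refine dvd_sub ((pow_dvd_pow x h1).trans ?_) ((pow_dvd_pow x h2).trans ?_)
      · rw [pow_add]
        exact mul_dvd_mul (Dvd.intro_left _ rfl) (ih j' (by omega) _)
      · rw [pow_add]
        exact mul_dvd_mul (Dvd.intro_left _ rfl) ((ih j' (by omega) _).mul_left _)
    match j, i, ih, step with
    | 0, i, _, _ => simp [geomOrd]
    | j + 1, i + 1, _, step =>
      exact step j i le_rfl _ (geomOrd_succ_le i j).1 (geomOrd_succ_le i j).2
    | 1, 0, _, _ => simp [geomOrd]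
    | j + 2, 0, ih, step =>
      obtain ⟨h1, h2, h3⟩ := geomOrd_zero_le j
      rw [geomOp_succ_apply]
      refine dvd_sub (step j 0 (by omega) _ (by rw [zero_add]; omega) (by omega)) ((pow_dvd_pow x h3).trans ?_)
      rw [pow_add]
      exact mul_dvd_mul (Dvd.intro_left _ rfl) (ih (j + 1) (by omega) _)

theorem sum_perm_geomOrd (n : ℕ) (π : Equiv.Perm (Fin n)) :
    5 * (n : ℤ) ^ 3 - 48 * n ^ 2 ≤ 24 * ∑ i, (geomOrd (π i) i : ℤ) := by
  have key : ∀ i j : ℕ, 4 * (n : ℤ) * i - (max (2 * (i : ℤ) - n) 0) ^ 2 +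
      (4 * n * j - 2 * n ^ 2 - (max (n - 2 * (j : ℤ)) 0) ^ 2) - 8 ≤ 8 * (geomOrd i j : ℤ) := by
    intro i j
    have hf : 8 * (i : ℤ) * j ≤ 8 * (geomOrd i j : ℤ) ∧
        (i < j → 2 * ((i : ℤ) + j) ^ 2 - 8 ≤ 8 * (geomOrd i j : ℤ)) := by
      have hd : (i + j) ^ 2 < 4 * ((i + j) ^ 2 / 4) + 4 := by omega
      have hm : j > i → i * j ≤ (i + j) ^ 2 / 4 := fun _ =>
        (Nat.le_div_iff_mul_le (by norm_num)).2 (by zify; nlinarith [sq_nonneg ((i : ℤ) - j)])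
      unfold geomOrd
      split_ifs with h
      · exact ⟨by push_cast; linarith, fun h' => by omega⟩
      · constructor
        · have := hm (by omega); zify at this; push_cast; linarith
        · intro _; zify at hd; push_cast; linarith
    obtain ⟨h1, h2⟩ := hf
    generalize (geomOrd i j : ℤ) = g at *
    rcases le_total (2 * (i : ℤ) - n) 0 with hi | hi <;>
      rcases le_total ((n : ℤ) - 2 * j) 0 with hj | hj <;>
      simp only [max_eq_left, max_eq_right, hi, hj]
    · by_cases hij : i < j
      · nlinarith [h2 hij, sq_nonneg ((i : ℤ) + j - n)]
      · have : (j : ℤ) ≤ i := by exact_mod_cast not_lt.1 hij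
        nlinarith [sq_nonneg ((i : ℤ) - j)]
    · nlinarith [mul_nonneg (neg_nonneg.2 hi) hj]
    · nlinarith [mul_nonneg hi (neg_nonneg.2 hj)]
    · nlinarith [sq_nonneg ((i : ℤ) + j - n)]
  have hsum := Finset.sum_le_sum fun (i : Fin n) (_ : i ∈ Finset.univ) => key (π i) i
  rw [← Finset.mul_sum] at hsum
  have h1 : ∑ i : Fin n, (4 * (n : ℤ) * (π i : ℕ) - (max (2 * ((π i : ℕ) : ℤ) - n) 0) ^ 2 +
      (4 * n * (i : ℕ) - 2 * n ^ 2 - (max (n - 2 * ((i : ℕ) : ℤ)) 0) ^ 2) - 8) =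
      ∑ i ∈ Finset.range n, (8 * (n : ℤ) * (i : ℤ) - 2 * n ^ 2 - (2 * (i : ℤ) - n) ^ 2 - 8) := by
    rw [Finset.sum_sub_distrib, Finset.sum_add_distrib,
      Equiv.sum_comp π fun i : Fin n =>
        4 * (n : ℤ) * (i : ℕ) - (max (2 * ((i : ℕ) : ℤ) - n) 0) ^ 2,
      ← Finset.sum_add_distrib, ← Finset.sum_sub_distrib,
      ← Fin.sum_univ_eq_sum_range
        (fun i : ℕ => (8 * (n : ℤ) * (i : ℤ) - 2 * n ^ 2 - (2 * (i : ℤ) - n) ^ 2 - 8)) n]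
    refine Finset.sum_congr rfl fun i _ => ?_
    rcases le_total (2 * ((i : ℕ) : ℤ) - n) 0 with hi | hi
    · rw [max_eq_right hi, max_eq_left (by linarith)]; ring
    · rw [max_eq_left hi, max_eq_right (by linarith)]; ring
  rw [h1] at hsum
  have h2 : ∀ k : ℕ, 3 * ∑ i ∈ Finset.range k,
      (8 * (n : ℤ) * (i : ℤ) - 2 * n ^ 2 - (2 * (i : ℤ) - n) ^ 2 - 8) =
      12 * (n : ℤ) * ((k : ℤ) * (k - 1)) - 6 * n ^ 2 * k - (2 * ((k : ℤ) * (k - 1) * (2 * k - 1)) -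
        6 * n * ((k : ℤ) * (k - 1)) + 3 * n ^ 2 * k) - 24 * k := by
    intro k
    induction k with
    | zero => simp
    | succ k ih => rw [Finset.sum_range_succ, mul_add, ih]; push_cast; ring
  have h3 := h2 n
  have h4 : (n : ℤ) ≤ n ^ 2 := by exact_mod_cast Nat.le_self_pow two_ne_zero n
  nlinarith

theorem pow_dvd_det_tschSeq [Nontrivial A] (n : ℕ) :
    x ^ ((5 * n ^ 3 - 48 * n ^ 2) / 24) ∣
      (Matrix.of fun i j : Fin n => tschSeq x d c a b (i + j)).det := by
  rw [← det_seqFunctional_mul _ n (fun i => X ^ i) (fun j => geomOp x a j)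
    (fun i => monic_X_pow i) (fun i => natDegree_X_pow i) (fun j => geomOp_monic x a j)
    (fun j => geomOp_natDegree x a j)]
  refine pow_dvd_det x _ (fun i j => geomOrd i j) (fun i j => ?_) _ fun π => ?_
  · rw [Matrix.of_apply, mul_comm, seqFunctional_mul_X_pow]
    exact pow_geomOrd_dvd x d c a b j i
  · have := sum_perm_geomOrd n π
    zify at *
    have h : ((5 * n ^ 3 - 48 * n ^ 2 : ℕ) : ℤ) ≤ 24 * ∑ i, (geomOrd (π i) i : ℤ) := by
      rcases le_total (48 * n ^ 2) (5 * n ^ 3) with h | h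
      · rw [Nat.cast_sub h]; push_cast; exact this
      · rw [Nat.sub_eq_zero_of_le h]
        exact_mod_cast Nat.zero_le _
    omega

end Tschakaloff

section Cyclotomic

open Polynomial

variable {A : Type*} [CommRing A]

/-- The sequences `f` whose `k`-th differences with step `l` are all divisible by
`y ^ ⌈(d + k) / 2⌉`. -/
def DiffDvd (y : A) (l d : ℕ) (f : ℕ → A) : Prop :=
  ∀ k n, y ^ ((d + k + 1) / 2) ∣ ((seqShift A ^ l - 1) ^ k) f n

theorem seqShift_sub_one_apply (l : ℕ) (f : ℕ → A) (n : ℕ) :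
    (seqShift A ^ l - 1) f n = f (n + l) - f n := by
  rw [LinearMap.sub_apply, Pi.sub_apply, seqShift_pow_apply, Module.End.one_apply]

theorem DiffDvd.diff {y : A} {l d : ℕ} {f : ℕ → A} (h : DiffDvd y l d f) :
    DiffDvd y l (d + 1) ((seqShift A ^ l - 1) f) := by
  intro k n
  have := h (k + 1) n
  rw [pow_succ, Module.End.mul_apply] at this
  rwa [show d + 1 + k + 1 = d + (k + 1) + 1 by ring]

theorem DiffDvd.mono {y : A} {l d d' : ℕ} {f : ℕ → A} (h : DiffDvd y l d f) (hd : d' ≤ d) :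
    DiffDvd y l d' f :=
  fun k n => (pow_dvd_pow y (by omega)).trans (h k n)

theorem DiffDvd.add {y : A} {l d : ℕ} {f g : ℕ → A} (hf : DiffDvd y l d f)
    (hg : DiffDvd y l d g) : DiffDvd y l d (f + g) := by
  intro k n
  rw [map_add]
  exact dvd_add (hf k n) (hg k n)

theorem DiffDvd.smul {y : A} {l d : ℕ} {f : ℕ → A} (hf : DiffDvd y l d f) (r : A) :
    DiffDvd y l d (r • f) := by
  intro k n
  rw [map_smul]
  exact (hf k n).mul_left r

theorem DiffDvd.mul {y : A} {l d e : ℕ} {f g : ℕ → A} (hf : DiffDvd y l d f)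
    (hg : DiffDvd y l e g) : DiffDvd y l (d + e) (f * g) := by
  intro k
  induction k generalizing d e f g with
  | zero =>
    intro n
    have h1 := hf 0 n
    have h2 := hg 0 n
    rw [pow_zero, Module.End.one_apply] at *
    refine (pow_dvd_pow y ?_).trans (pow_add y _ _ ▸ mul_dvd_mul h1 h2)
    omega
  | succ k ih =>
    intro n
    have h : (seqShift A ^ l - 1) (f * g) =
        (seqShift A ^ l - 1) f * g + f * (seqShift A ^ l - 1) g +
          (seqShift A ^ l - 1) f * (seqShift A ^ l - 1) g := by
      ext m
      simp only [Pi.add_apply, Pi.mul_apply, seqShift_sub_one_apply]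
      ring
    rw [pow_succ, Module.End.mul_apply, h, map_add, map_add]
    refine dvd_add (dvd_add ?_ ?_) ?_
    · exact (pow_dvd_pow y (by omega)).trans (ih hf.diff hg n)
    · exact (pow_dvd_pow y (by omega)).trans (ih hf hg.diff n)
    · exact (pow_dvd_pow y (by omega)).trans (ih hf.diff hg.diff n)

variable (x d c a b : A) (l : ℕ)

theorem sub_one_dvd_pow_mul_sub_one (m : ℕ) : x ^ l - 1 ∣ x ^ (l * m) - 1 := by
  rw [pow_mul]
  exact sub_one_dvd_pow_sub_one _ _

theorem diffDvd_pow_sub_one :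
    DiffDvd (x ^ l - 1) l 1 (fun n => x ^ (l * n) - 1) := by
  have h : ∀ k n, ((seqShift A ^ l - 1) ^ (k + 1)) (fun n => x ^ (l * n) - 1) n =
      (x ^ (l * l) - 1) ^ (k + 1) * x ^ (l * n) := by
    intro k
    induction k with
    | zero =>
      intro n
      rw [zero_add, pow_one, seqShift_sub_one_apply]
      ring
    | succ k ih =>
      intro n
      rw [pow_succ', Module.End.mul_apply, seqShift_sub_one_apply, ih, ih]
      ring
  intro k n
  cases k with
  | zero => simpa using sub_one_dvd_pow_mul_sub_one x l n
  | succ k =>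
    rw [h]
    exact ((pow_dvd_pow _ (by omega)).trans
      (pow_dvd_pow_of_dvd (sub_one_dvd_pow_mul_sub_one x l l) _)).mul_right _

theorem tschSeq_add_eq : ∃ (ε : A) (G : A[X]), ∀ n, tschSeq x d c a b (n + l) =
    ε * x ^ (l * n) * tschSeq x d c a b n + a ^ n * G.eval (x ^ n) := by
  induction l with
  | zero => exact ⟨1, 0, fun n => by simp⟩
  | succ l ih =>
    obtain ⟨ε, G, h⟩ := ih
    refine ⟨x ^ (l + 1) * d * ε, C (x ^ (l + 1)) * X * (C d * G - C (c * a ^ l)), fun n => ?_⟩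
    rw [← add_assoc, tschSeq, h]
    simp only [eval_mul, eval_sub, eval_C, eval_X]
    ring

theorem seqShift_pow_sub_C_apply (r : A) (w : ℕ → A) (n : ℕ) :
    aeval (seqShift A) (X ^ l - C r) w n = w (n + l) - r * w n := by
  rw [map_sub, map_pow, aeval_X, aeval_C, LinearMap.sub_apply, Pi.sub_apply, seqShift_pow_apply,
    Module.algebraMap_end_apply, Pi.smul_apply, smul_eq_mul]

theorem aeval_pow_tschSeq {ε : A} {H : A[X]} (h : ∀ n, tschSeq x d c a b (n + l) =
    ε * x ^ (l * n) * tschSeq x d c a b n + a ^ n * H.eval (x ^ n)) (k : ℕ) :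
    ∃ F G : A[X], DiffDvd (x ^ l - 1) l k (fun n => F.eval (x ^ n)) ∧
      ∀ n, aeval (seqShift A) ((X ^ l - C ε) ^ k) (tschSeq x d c a b) n =
        F.eval (x ^ n) * tschSeq x d c a b n + a ^ n * G.eval (x ^ n) := by
  induction k with
  | zero =>
    refine ⟨1, 0, ?_, fun n => by simp⟩
    intro k n
    cases k with
    | zero => simp
    | succ k =>
      have : (seqShift A ^ l - 1) (fun n => (1 : A[X]).eval (x ^ n)) = 0 := by
        ext m; rw [seqShift_sub_one_apply]; simp
      rw [pow_succ, Module.End.mul_apply, this, map_zero]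
      exact dvd_zero _
  | succ k ih =>
    obtain ⟨F, G, hF, hG⟩ := ih
    refine ⟨C ε * (X ^ l * F.comp (C (x ^ l) * X) - F), F.comp (C (x ^ l) * X) * H +
      C (a ^ l) * G.comp (C (x ^ l) * X) - C ε * G, ?_, fun n => ?_⟩
    · have h1 : (fun n => (C ε * (X ^ l * F.comp (C (x ^ l) * X) - F)).eval (x ^ n)) =
          ε • ((fun n => x ^ (l * n) - 1) * ((fun n => F.eval (x ^ n)) +
            (seqShift A ^ l - 1) fun n => F.eval (x ^ n)) +
              (seqShift A ^ l - 1) fun n => F.eval (x ^ n)) := by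
        ext m
        simp only [eval_mul, eval_sub, eval_C, eval_X, eval_pow, eval_comp, Pi.smul_apply,
          Pi.add_apply, Pi.mul_apply, seqShift_sub_one_apply, smul_eq_mul]
        rw [← pow_add, add_comm l m]
        ring
      rw [h1]
      have h2 := (diffDvd_pow_sub_one x l).mul (hF.add (hF.diff.mono (Nat.le_succ _)))
      rw [add_comm] at h2
      exact (h2.add hF.diff).smul ε
    · rw [pow_succ', map_mul, Module.End.mul_apply, seqShift_pow_sub_C_apply, hG, hG, h]
      simp only [eval_mul, eval_sub, eval_add, eval_C, eval_X, eval_pow, eval_comp]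
      rw [← pow_add, add_comm l n]
      ring

theorem aeval_pow_geom (G : A[X]) (k : ℕ) : ∃ G' : A[X],
    ∀ n, aeval (seqShift A) ((X ^ l - C (a ^ l)) ^ k) (fun n => a ^ n * G.eval (x ^ n)) n =
      (x ^ l - 1) ^ k * (a ^ n * G'.eval (x ^ n)) := by
  induction k with
  | zero => exact ⟨G, fun n => by simp⟩
  | succ k ih =>
    obtain ⟨G', h⟩ := ih
    have h1 : C (x ^ l - 1) ∣ G'.comp (C (x ^ l) * X) - G' := by
      rw [C_dvd_iff_dvd_coeff]
      intro m
      rw [coeff_sub, comp_C_mul_X_coeff, ← pow_mul, ← mul_sub_one]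
      exact (sub_one_dvd_pow_mul_sub_one x l m).mul_left _
    obtain ⟨G'', h2⟩ := h1
    refine ⟨C (a ^ l) * G'', fun n => ?_⟩
    have h3 := congrArg (eval (x ^ n)) h2
    simp only [eval_mul, eval_sub, eval_C, eval_X, eval_comp] at h3
    rw [pow_succ', map_mul, Module.End.mul_apply, seqShift_pow_sub_C_apply, h, h, pow_add x n l,
      mul_comm (x ^ n) (x ^ l), eval_mul, eval_C]
    linear_combination (x ^ l - 1) ^ k * a ^ n * a ^ l * h3

theorem dvd_aeval_seqShift {y : A} {w : ℕ → A} (h : ∀ n, y ∣ w n) (P : A[X]) (n : ℕ) :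
    y ∣ aeval (seqShift A) P w n := by
  choose v hv using h
  have : w = y • v := funext hv
  rw [this, map_smul]
  exact Dvd.intro _ rfl

theorem pow_dvd_aeval_tschSeq {ε : A} {H : A[X]} (h : ∀ n, tschSeq x d c a b (n + l) =
    ε * x ^ (l * n) * tschSeq x d c a b n + a ^ n * H.eval (x ^ n)) (k m n : ℕ) :
    (x ^ l - 1) ^ min ((k + 1) / 2) m ∣
      aeval (seqShift A) ((X ^ l - C ε) ^ k * (X ^ l - C (a ^ l)) ^ m) (tschSeq x d c a b) n := by
  obtain ⟨F, G, hF, hG⟩ := aeval_pow_tschSeq x d c a b l h k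
  obtain ⟨G', hG'⟩ := aeval_pow_geom x a l G m
  have h1 : aeval (seqShift A) ((X ^ l - C ε) ^ k) (tschSeq x d c a b) =
      (fun n => F.eval (x ^ n) * tschSeq x d c a b n) + fun n => a ^ n * G.eval (x ^ n) :=
    funext hG
  rw [mul_comm, map_mul, Module.End.mul_apply, h1, map_add, Pi.add_apply]
  refine dvd_add (dvd_aeval_seqShift (fun j => ?_) _ _) ?_
  · have := hF 0 j
    rw [pow_zero, Module.End.one_apply, add_zero] at this
    exact ((pow_dvd_pow _ (min_le_left _ _)).trans this).mul_right _
  · rw [hG']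
    exact (pow_dvd_pow _ (min_le_right _ _)).mul_right _

/-- The monic operator of degree `i` adapted to divisibility by `x ^ l - 1`. -/
noncomputable def cyclOp (ε : A) (i : ℕ) : A[X] :=
  X ^ (i % l) * ((X ^ l - C ε) ^ (i / l - (i / l + 1) / 3) *
    (X ^ l - C (a ^ l)) ^ ((i / l + 1) / 3))

theorem cyclOp_monic {l : ℕ} (hl : l ≠ 0) (ε : A) (i : ℕ) : (cyclOp a l ε i).Monic :=
  (monic_X_pow _).mul (((monic_X_pow_sub_C _ hl).pow _).mul ((monic_X_pow_sub_C _ hl).pow _))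

theorem cyclOp_natDegree [Nontrivial A] {l : ℕ} (hl : l ≠ 0) (ε : A) (i : ℕ) :
    (cyclOp a l ε i).natDegree = i := by
  rw [cyclOp, (monic_X_pow _).natDegree_mul
    (((monic_X_pow_sub_C _ hl).pow _).mul ((monic_X_pow_sub_C _ hl).pow _)),
    ((monic_X_pow_sub_C _ hl).pow _).natDegree_mul ((monic_X_pow_sub_C _ hl).pow _),
    (monic_X_pow_sub_C _ hl).natDegree_pow, (monic_X_pow_sub_C _ hl).natDegree_pow,
    natDegree_X_pow_sub_C, natDegree_X_pow_sub_C, natDegree_X_pow, ← add_mul,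
    Nat.sub_add_cancel (by generalize i / l = t; omega), Nat.mod_add_div']

theorem pow_sub_one_dvd_det_tschSeq [Nontrivial A] {l : ℕ} (hl : l ≠ 0) (n : ℕ) :
    (x ^ l - 1) ^ (∑ i ∈ Finset.range n, (i / l - (i / l + 2) / 3)) ∣
      (Matrix.of fun i j : Fin n => tschSeq x d c a b (i + j)).det := by
  obtain ⟨ε, H, h⟩ := tschSeq_add_eq x d c a b l
  rw [← det_seqFunctional_mul _ n (cyclOp a l ε) (cyclOp a l ε) (cyclOp_monic a hl ε)
    (cyclOp_natDegree a hl ε) (cyclOp_monic a hl ε) (cyclOp_natDegree a hl ε)]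
  refine pow_dvd_det _ _ (fun i j =>
    min ((i / l - (i / l + 1) / 3 + (j / l - (j / l + 1) / 3) + 1) / 2)
      ((i / l + 1) / 3 + (j / l + 1) / 3)) (fun i j => ?_) _ fun π => ?_
  · have h1 : cyclOp a l ε i * cyclOp a l ε j =
        (X ^ l - C ε) ^ ((i : ℕ) / l - (i / l + 1) / 3 + (j / l - (j / l + 1) / 3)) *
          (X ^ l - C (a ^ l)) ^ ((i / l + 1) / 3 + (j / l + 1) / 3) *
            X ^ ((i : ℕ) % l + j % l) := by
      unfold cyclOp
      ring
    rw [Matrix.of_apply, h1, seqFunctional_mul_X_pow]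
    exact pow_dvd_aeval_tschSeq x d c a b l h _ _ _
  · set w : ℕ → ℕ := fun i => i / l - (i / l + 2) / 3 with hw
    have h1 : ∑ i : Fin n, (w (π i) + w i) = 2 * ∑ i ∈ Finset.range n, w i := by
      rw [Finset.sum_add_distrib, Equiv.sum_comp π fun i : Fin n => w i,
        Fin.sum_univ_eq_sum_range w n, two_mul]
    have h2 := Finset.sum_le_sum (s := Finset.univ) (f := fun i : Fin n => w (π i) + w i)
      (g := fun i : Fin n => 2 * min (((π i : ℕ) / l - ((π i : ℕ) / l + 1) / 3 +
        ((i : ℕ) / l - ((i : ℕ) / l + 1) / 3) + 1) / 2)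
      (((π i : ℕ) / l + 1) / 3 + ((i : ℕ) / l + 1) / 3)) fun i _ => by
        simp only [hw]
        have key : ∀ t : ℕ, t - (t + 2) / 3 ≤ t - (t + 1) / 3 ∧
            t - (t + 2) / 3 ≤ 2 * ((t + 1) / 3) := fun t => by omega
        have hs := key ((π i : ℕ) / l)
        have ht := key ((i : ℕ) / l)
        rw [← Nat.mul_min_mul_left]
        exact le_min (by omega) (by omega)
    rw [h1, ← Finset.mul_sum] at h2
    exact Nat.le_of_mul_le_mul_left h2 two_pos

end Cyclotomic

section Divisor

open Polynomial

/-- The exponent of the `l`-th cyclotomic polynomial in the divisor of the Hankel determinant,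
counting only the part coming from `S`. -/
def cyclExp (S : Finset ℕ) (n l : ℕ) : ℕ := ∑ i ∈ Finset.range n, (S.filter fun s => s * l ≤ i).card

/-- The monic divisor of the Hankel determinants of the Tschakaloff sequence. -/
noncomputable def cyclDivisor (R : Type*) [CommRing R] (S : Finset ℕ) (n : ℕ) : R[X] :=
  X ^ ((5 * n ^ 3 - 48 * n ^ 2) / 24) * ∏ l ∈ Finset.Icc 1 n, cyclotomic l R ^ cyclExp S n l

theorem cyclDivisor_monic (R : Type*) [CommRing R] (S : Finset ℕ) (n : ℕ) :
    (cyclDivisor R S n).Monic :=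
  (monic_X_pow _).mul (monic_prod_of_monic _ _ fun l _ => (cyclotomic.monic l R).pow _)

theorem natDegree_cyclDivisor (R : Type*) [CommRing R] [Nontrivial R] (S : Finset ℕ) (n : ℕ) :
    (cyclDivisor R S n).natDegree = (5 * n ^ 3 - 48 * n ^ 2) / 24 +
      ∑ l ∈ Finset.Icc 1 n, l.totient * cyclExp S n l := by
  rw [cyclDivisor, (monic_X_pow _).natDegree_mul
    (monic_prod_of_monic _ _ fun l _ => (cyclotomic.monic l R).pow _), natDegree_X_pow,
    natDegree_prod_of_monic _ _ fun l _ => (cyclotomic.monic l R).pow _]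
  congr 1
  refine Finset.sum_congr rfl fun l _ => ?_
  rw [(cyclotomic.monic l R).natDegree_pow, natDegree_cyclotomic, mul_comm]

theorem card_filter_mod_three (t : ℕ) :
    ((Finset.Icc 1 t).filter fun s => s % 3 ≠ 1).card = t - (t + 2) / 3 := by
  induction t with
  | zero => rfl
  | succ t ih =>
    rw [← Finset.insert_Icc_right_eq_Icc_add_one (by omega), Finset.filter_insert]
    split_ifs with h
    · rw [Finset.card_insert_of_notMem (by simp), ih]
      omega
    · rw [ih]
      omega

theorem cyclExp_le {S : Finset ℕ} (hS : ∀ s ∈ S, 1 ≤ s ∧ s % 3 ≠ 1) {l : ℕ} (hl : l ≠ 0) (n : ℕ) :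
    cyclExp S n l ≤ ∑ i ∈ Finset.range n, (i / l - (i / l + 2) / 3) := by
  refine Finset.sum_le_sum fun i _ => ?_
  rw [← card_filter_mod_three]
  refine Finset.card_le_card fun s hs => ?_
  rw [Finset.mem_filter] at hs ⊢
  rw [Finset.mem_Icc]
  exact ⟨⟨(hS s hs.1).1, (Nat.le_div_iff_mul_le (Nat.pos_of_ne_zero hl)).2 hs.2⟩, (hS s hs.1).2⟩

theorem cyclDivisor_dvd_det {R : Type*} [CommRing R] [IsDomain R] [CharZero R] {S : Finset ℕ}
    (hS : ∀ s ∈ S, 1 ≤ s ∧ s % 3 ≠ 1) (d c a b : R[X]) (n : ℕ) :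
    cyclDivisor R S n ∣ (Matrix.of fun i j : Fin n => tschSeq X d c a b (i + j)).det := by
  set D := (Matrix.of fun i j : Fin n => tschSeq X d c a b (i + j)).det
  set f := algebraMap R (FractionRing R)
  have hf : Function.Injective f := IsFractionRing.injective R (FractionRing R)
  have : CharZero (FractionRing R) := charZero_of_injective_algebraMap hf
  have h0 : ∀ l ∈ Finset.Icc 1 n, l ≠ 0 := fun l hl => by
    have := (Finset.mem_Icc.1 hl).1
    omega
  rw [← map_dvd_map f hf (cyclDivisor_monic R S n), cyclDivisor, Polynomial.map_mul,
    Polynomial.map_prod]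
  simp only [Polynomial.map_pow, map_X, map_cyclotomic]
  refine IsCoprime.mul_dvd ?_ ?_ ?_
  · refine IsCoprime.prod_right fun l hl => IsCoprime.pow ?_
    refine IsCoprime.of_isCoprime_of_dvd_right ?_ (cyclotomic.dvd_X_pow_sub_one l _)
    refine ⟨X ^ (l - 1), -1, ?_⟩
    rw [← pow_succ, Nat.sub_add_cancel (Finset.mem_Icc.1 hl).1]
    ring
  · have := Polynomial.map_dvd f (pow_dvd_det_tschSeq (X : R[X]) d c a b n)
    rwa [Polynomial.map_pow, map_X] at this
  · refine Finset.prod_dvd_of_coprime ?_ fun l hl => ?_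
    · intro k hk l hl hkl
      refine IsCoprime.pow ?_
      have := (cyclotomic.isCoprime_rat hkl).map (mapRingHom (algebraMap ℚ (FractionRing R)))
      simpa using this
    · have := Polynomial.map_dvd f (((pow_dvd_pow_of_dvd (cyclotomic.dvd_X_pow_sub_one l R) _).trans
        (pow_dvd_pow _ (cyclExp_le hS (h0 l hl) n))).trans
        (pow_sub_one_dvd_det_tschSeq (X : R[X]) d c a b (h0 l hl) n))
      rwa [Polynomial.map_pow, map_cyclotomic] at this

theorem natDegree_tschSeq_le {R : Type*} [CommRing R] (d c a b : R) (m : ℕ) :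
    2 * (tschSeq X (C d) (C c) (C a) (C b) m : R[X]).natDegree ≤ m * (m + 1) := by
  induction m with
  | zero => simp [tschSeq]
  | succ m ih =>
    rw [tschSeq, ← C_pow, ← C_mul]
    have h1 := natDegree_mul_le (p := (X : R[X]) ^ (m + 1))
      (q := C d * tschSeq X (C d) (C c) (C a) (C b) m - C (c * a ^ m))
    have h2 := natDegree_X_pow_le (R := R) (m + 1)
    have h3 := natDegree_sub_le (C d * tschSeq X (C d) (C c) (C a) (C b) m) (C (c * a ^ m))
    have h4 := natDegree_C_mul_le d (tschSeq X (C d) (C c) (C a) (C b) m)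
    rw [natDegree_C, max_eq_left (Nat.zero_le _)] at h3
    nlinarith

theorem natDegree_det_tschSeq_le {R : Type*} [CommRing R] (d c a b : R) (n : ℕ) :
    3 * (Matrix.of fun i j : Fin n =>
      (tschSeq X (C d) (C c) (C a) (C b) (i + j) : R[X])).det.natDegree ≤ 2 * n ^ 3 := by
  have h := natDegree_det_le (Matrix.of fun i j : Fin n =>
    (tschSeq X (C d) (C c) (C a) (C b) (i + j) : R[X])) (fun i => i ^ 2 + i) (fun i => i ^ 2 + i)
    fun i j => by
      rw [Matrix.of_apply]
      have := natDegree_tschSeq_le d c a b (i + j)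
      zify at *
      nlinarith [sq_nonneg ((i : ℤ) - j)]
  rw [Fin.sum_univ_eq_sum_range (fun i => i ^ 2 + i + (i ^ 2 + i)) n] at h
  have h2 : ∀ k : ℕ, 3 * ∑ i ∈ Finset.range k, (i ^ 2 + i + (i ^ 2 + i)) ≤ 2 * k ^ 3 := by
    intro k
    induction k with
    | zero => simp
    | succ k ih => rw [Finset.sum_range_succ]; nlinarith
  exact (Nat.mul_le_mul_left 3 h).trans (h2 n)

end Divisor

section Totient
open Filter Topology

theorem tsum_moebius_div_sq :
    ∑' n : ℕ, ((ArithmeticFunction.moebius n : ℤ) : ℝ) * (1 / (2 * (n : ℝ) ^ 2)) =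
      3 / Real.pi ^ 2 := by
  have h2 : (1 : ℝ) < (2 : ℂ).re := by norm_num
  have h := ArithmeticFunction.LSeries_zeta_mul_Lseries_moebius h2
  rw [ArithmeticFunction.LSeries_zeta_eq_riemannZeta h2, riemannZeta_two] at h
  have h3 : LSeries (fun n => ((ArithmeticFunction.moebius n : ℤ) : ℂ)) 2 =
      ((∑' n : ℕ, ((ArithmeticFunction.moebius n : ℤ) : ℝ) * (1 / (2 * (n : ℝ) ^ 2)) * 2 : ℝ) : ℂ) := by
    rw [LSeries, Complex.ofReal_tsum]
    refine tsum_congr fun n => ?_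
    rcases eq_or_ne n 0 with rfl | hn
    · simp
    · rw [LSeries.term_of_ne_zero hn]
      have : (n : ℂ) ≠ 0 := by exact_mod_cast hn
      push_cast
      rw [Complex.cpow_ofNat]
      field_simp
  rw [h3, tsum_mul_right] at h
  set M := ∑' n : ℕ, ((ArithmeticFunction.moebius n : ℤ) : ℝ) * (1 / (2 * (n : ℝ) ^ 2))
  have h4 : Real.pi ^ 2 / 6 * (M * 2) = 1 := by exact_mod_cast h
  have := Real.pi_pos
  field_simp
  linarith

theorem sum_totient_eq (y : ℕ) : ∑ l ∈ Finset.Icc 1 y, (l.totient : ℝ) =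
    ∑' d : ℕ, ((ArithmeticFunction.moebius d : ℤ) : ℝ) *
      (((y / d : ℕ) : ℝ) * ((y / d : ℕ) + 1) / 2) := by
  let φ : ArithmeticFunction ℝ := ⟨fun n => n.totient, by simp⟩
  let ι : ArithmeticFunction ℝ := ⟨fun n => n, by simp⟩
  have h1 : φ = (ArithmeticFunction.moebius : ArithmeticFunction ℝ) * ι := by
    have : ((ArithmeticFunction.zeta : ArithmeticFunction ℝ)) * φ = ι := by
      ext n
      rw [ArithmeticFunction.coe_zeta_mul_apply]
      change ∑ i ∈ n.divisors, (i.totient : ℝ) = n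
      exact_mod_cast Nat.sum_totient n
    rw [← this, ← mul_assoc, ArithmeticFunction.coe_moebius_mul_coe_zeta, one_mul]
  have hT : ∀ k : ℕ, ∑ m ∈ Finset.Ioc 0 k, ι m = (k : ℝ) * (k + 1) / 2 := by
    intro k
    induction k with
    | zero => simp
    | succ k ih =>
      rw [← Finset.insert_Ioc_right_eq_Ioc_add_one (by omega), Finset.sum_insert (by simp), ih]
      change ((k + 1 : ℕ) : ℝ) + _ = _
      push_cast
      ring
  have h2 := ArithmeticFunction.sum_Ioc_mul_eq_sum_sum
    (ArithmeticFunction.moebius : ArithmeticFunction ℝ) ι y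
  rw [← h1] at h2
  change ∑ l ∈ Finset.Ioc 0 y, (l.totient : ℝ) = _
  refine h2.trans ?_
  rw [tsum_eq_sum (s := Finset.Ioc 0 y)]
  · refine Finset.sum_congr rfl fun d _ => ?_
    rw [hT, ArithmeticFunction.intCoe_apply]
  · intro d hd
    rcases Nat.eq_zero_or_pos d with rfl | h
    · simp
    · have : y < d := by simpa [h] using hd
      rw [Nat.div_eq_of_lt this]
      simp

theorem tendsto_sum_totient_div_sq :
    Tendsto (fun y : ℕ => (∑ l ∈ Finset.Icc 1 y, (l.totient : ℝ)) / (y : ℝ) ^ 2) atTop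
      (𝓝 (3 / Real.pi ^ 2)) := by
  simp_rw [sum_totient_eq, ← tsum_moebius_div_sq, ← tsum_div_const, mul_div_assoc]
  have hsum : Summable fun d : ℕ => 1 / (d : ℝ) ^ 2 := Real.summable_one_div_nat_pow.2 one_lt_two
  refine tendsto_tsum_of_dominated_convergence hsum (fun d => Tendsto.const_mul _ ?_) ?_
  · have hy : Tendsto (fun y : ℕ => ((y / d : ℕ) : ℝ) / y) atTop (𝓝 (1 / d)) := by
      have := (tendsto_nat_floor_mul_div_atTop (R := ℝ) (a := 1 / d) (by positivity)).comp
        tendsto_natCast_atTop_atTop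
      refine this.congr fun y => ?_
      simp only [Function.comp]
      rw [one_div_mul_eq_div, Nat.floor_div_eq_div]
    have h0 : Tendsto (fun y : ℕ => 1 / (y : ℝ)) atTop (𝓝 0) := tendsto_one_div_atTop_nhds_zero_nat
    have h := (hy.mul (hy.add h0)).div_const 2
    rw [show 1 / (d : ℝ) * (1 / d + 0) / 2 = 1 / (2 * (d : ℝ) ^ 2) by
      rw [add_zero, div_mul_div_comm, div_div]; ring_nf] at h
    refine h.congr fun y => ?_
    rcases eq_or_ne (y : ℝ) 0 with hy0 | hy0
    · simp [hy0]
    · field_simp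
  · filter_upwards [eventually_gt_atTop 0] with y hy d
    have hy' : (0 : ℝ) < y := by exact_mod_cast hy
    rcases Nat.eq_zero_or_pos d with rfl | hd
    · simp
    have hd' : (0 : ℝ) < d := by exact_mod_cast hd
    have h1 : |((ArithmeticFunction.moebius d : ℤ) : ℝ)| ≤ 1 := by
      exact_mod_cast ArithmeticFunction.abs_moebius_le_one
    have h2 : ((y / d : ℕ) : ℝ) ≤ y / d := Nat.cast_div_le
    have h3 : ((y / d : ℕ) : ℝ) * (((y / d : ℕ) : ℝ) + 1) / 2 ≤ ((y / d : ℕ) : ℝ) ^ 2 := by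
      rcases Nat.eq_zero_or_pos (y / d) with h | h
      · simp [h]
      · have : (1 : ℝ) ≤ (y / d : ℕ) := by exact_mod_cast h
        nlinarith
    rw [norm_mul, Real.norm_eq_abs, Real.norm_of_nonneg (by positivity), ← one_mul (1 / _)]
    refine mul_le_mul h1 ?_ (by positivity) zero_le_one
    rw [← mul_div_assoc, ← mul_div_assoc, div_le_iff₀ (by positivity)]
    calc _ ≤ _ := h3
      _ ≤ ((y : ℝ) / d) ^ 2 := by gcongr
      _ = 1 / (d : ℝ) ^ 2 * (y : ℝ) ^ 2 := by rw [div_pow]; ring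

theorem exists_le_sum_totient {κ : ℝ} (hκ : κ < 3 / Real.pi ^ 2) :
    ∃ B : ℝ, ∀ y : ℕ, κ * (y : ℝ) ^ 2 - B ≤ ∑ l ∈ Finset.Icc 1 y, (l.totient : ℝ) := by
  obtain ⟨N, hN⟩ := eventually_atTop.1 (tendsto_sum_totient_div_sq.eventually_const_lt hκ)
  refine ⟨|κ| * (N : ℝ) ^ 2, fun y => ?_⟩
  have h0 : 0 ≤ ∑ l ∈ Finset.Icc 1 y, (l.totient : ℝ) := Finset.sum_nonneg fun _ _ => by positivity
  have h1 : 0 ≤ |κ| * (N : ℝ) ^ 2 := by positivity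
  rcases le_total N y with h | h
  · rcases Nat.eq_zero_or_pos y with rfl | hy
    · simpa using h1
    have h2 := hN y h
    rw [lt_div_iff₀ (by positivity)] at h2
    linarith
  · have h2 : (y : ℝ) ≤ N := by exact_mod_cast h
    have h3 : κ * (y : ℝ) ^ 2 ≤ |κ| * (N : ℝ) ^ 2 :=
      mul_le_mul (le_abs_self _) (by gcongr) (by positivity) (abs_nonneg _)
    linarith

end Totient

section DivisorSize

open Polynomial

theorem sum_totient_mul_cyclExp {S : Finset ℕ} (hS : ∀ s ∈ S, 1 ≤ s) (n : ℕ) :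
    ∑ l ∈ Finset.Icc 1 n, l.totient * cyclExp S n l =
      ∑ s ∈ S, ∑ i ∈ Finset.range n, ∑ l ∈ Finset.Icc 1 (i / s), l.totient := by
  have h1 : ∀ l, l.totient * cyclExp S n l =
      ∑ s ∈ S, ∑ i ∈ Finset.range n, if s * l ≤ i then l.totient else 0 := by
    intro l
    rw [cyclExp, Finset.sum_comm, Finset.mul_sum]
    refine Finset.sum_congr rfl fun i _ => ?_
    rw [Finset.sum_ite, Finset.sum_const, Finset.sum_const_zero, add_zero, smul_eq_mul, mul_comm]
  rw [Finset.sum_congr rfl fun l _ => h1 l, Finset.sum_comm]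
  refine Finset.sum_congr rfl fun s hs => ?_
  rw [Finset.sum_comm]
  refine Finset.sum_congr rfl fun i hi => ?_
  rw [← Finset.sum_filter]
  refine Finset.sum_congr ?_ fun _ _ => rfl
  ext l
  have h2 : i / s ≤ n := (Nat.div_le_self _ _).trans (Finset.mem_range.1 hi).le
  have h3 : l ≤ i / s ↔ s * l ≤ i := by
    rw [Nat.le_div_iff_mul_le (hS s hs), mul_comm]
  rw [Finset.mem_filter, Finset.mem_Icc, Finset.mem_Icc, ← h3]
  omega

theorem le_sum_sq (n : ℕ) : (n : ℝ) ^ 3 / 3 - (n : ℝ) ^ 2 ≤ ∑ i ∈ Finset.range n, (i : ℝ) ^ 2 := by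
  induction n with
  | zero => simp
  | succ n ih =>
    rw [Finset.sum_range_succ]
    push_cast
    nlinarith [(Nat.cast_nonneg n : (0 : ℝ) ≤ n)]

theorem exists_le_natDegree_cyclDivisor {κ : ℝ} (hκ0 : 0 ≤ κ) (hκ : κ < 3 / Real.pi ^ 2)
    {S : Finset ℕ} (hS : ∀ s ∈ S, 1 ≤ s) :
    ∃ B : ℝ, ∀ (R : Type) [CommRing R] [Nontrivial R] (n : ℕ),
      (5 / 24 + κ / 3 * ∑ s ∈ S, 1 / (s : ℝ) ^ 2) * (n : ℝ) ^ 3 - B * (n : ℝ) ^ 2 ≤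
        (cyclDivisor R S n).natDegree := by
  obtain ⟨B, hB⟩ := exists_le_sum_totient hκ
  refine ⟨3 + S.card * (3 * κ + |B|), fun R _ _ n => ?_⟩
  have hn : (n : ℝ) ≤ (n : ℝ) ^ 2 := by exact_mod_cast Nat.le_self_pow two_ne_zero n
  have h1 : ∀ s ∈ S, ∀ i ∈ Finset.range n,
      κ / (s : ℝ) ^ 2 * (i : ℝ) ^ 2 - (2 * κ * n + |B|) ≤
        ((∑ l ∈ Finset.Icc 1 (i / s), l.totient : ℕ) : ℝ) := by
    intro s hs i hi
    have hs' : (1 : ℝ) ≤ s := by exact_mod_cast hS s hs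
    have hi' : (i : ℝ) ≤ n := by exact_mod_cast (Finset.mem_range.1 hi).le
    have h2 : (i : ℝ) / s < (i / s : ℕ) + 1 := by
      rw [div_lt_iff₀ (by linarith)]
      have h := Nat.div_add_mod i s
      have h' := Nat.mod_lt i (hS s hs)
      have : i < (i / s + 1) * s := by linarith
      exact_mod_cast this
    have h3 : ((i / s : ℕ) : ℝ) ≤ (i : ℝ) / s := Nat.cast_div_le
    have h4 : (i : ℝ) / s ≤ n := (div_le_self (Nat.cast_nonneg _) hs').trans hi'
    have h5 : ((i : ℝ) / s) ^ 2 - 2 * n ≤ ((i / s : ℕ) : ℝ) ^ 2 := by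
      nlinarith [(Nat.cast_nonneg (i / s) : (0 : ℝ) ≤ _)]
    have h6 := mul_le_mul_of_nonneg_left h5 hκ0
    have h7 := hB (i / s)
    have h8 := le_abs_self B
    rw [Nat.cast_sum]
    have h9 : κ / (s : ℝ) ^ 2 * (i : ℝ) ^ 2 = κ * ((i : ℝ) / s) ^ 2 := by
      rw [div_pow]; ring
    linarith
  have h2 : ∀ s ∈ S, κ / 3 * (1 / (s : ℝ) ^ 2) * (n : ℝ) ^ 3 - (3 * κ + |B|) * (n : ℝ) ^ 2 ≤
      ∑ i ∈ Finset.range n, ((∑ l ∈ Finset.Icc 1 (i / s), l.totient : ℕ) : ℝ) := by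
    intro s hs
    refine le_trans ?_ (Finset.sum_le_sum (h1 s hs))
    rw [Finset.sum_sub_distrib, ← Finset.mul_sum, Finset.sum_const, Finset.card_range, nsmul_eq_mul]
    have hs' : (1 : ℝ) ≤ s := by exact_mod_cast hS s hs
    have h3 : κ / (s : ℝ) ^ 2 ≤ κ := div_le_self hκ0 (one_le_pow₀ hs')
    have h4 := mul_le_mul_of_nonneg_left (le_sum_sq n) (div_nonneg hκ0 (sq_nonneg (s : ℝ)))
    have h5 := mul_le_mul_of_nonneg_right h3 (sq_nonneg (n : ℝ))
    have h6 := mul_le_mul_of_nonneg_left hn (abs_nonneg B)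
    have h7 : κ / 3 * (1 / (s : ℝ) ^ 2) * (n : ℝ) ^ 3 = κ / (s : ℝ) ^ 2 * ((n : ℝ) ^ 3 / 3) := by
      ring
    nlinarith
  have h3 := Finset.sum_le_sum h2
  rw [Finset.sum_sub_distrib, ← Finset.sum_mul, ← Finset.mul_sum, Finset.sum_const,
    nsmul_eq_mul] at h3
  rw [natDegree_cyclDivisor, sum_totient_mul_cyclExp hS]
  push_cast at h3 ⊢
  have h4 : (5 / 24 : ℝ) * (n : ℝ) ^ 3 - 3 * (n : ℝ) ^ 2 ≤
      ((5 * n ^ 3 - 48 * n ^ 2) / 24 : ℕ) := by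
    rcases Nat.eq_zero_or_pos n with rfl | h0
    · simp
    have h5 : 5 * n ^ 3 ≤ 24 * ((5 * n ^ 3 - 48 * n ^ 2) / 24) + 48 * n ^ 2 + 24 := by omega
    have h6 : (5 : ℝ) * n ^ 3 ≤ 24 * ((5 * n ^ 3 - 48 * n ^ 2) / 24 : ℕ) + 48 * n ^ 2 + 24 := by
      exact_mod_cast h5
    have h7 : (1 : ℝ) ≤ n ^ 2 := by exact_mod_cast Nat.one_le_pow _ _ h0
    linarith
  linarith

theorem sum_cyclExp_le (S : Finset ℕ) (n : ℕ) :
    ∑ l ∈ Finset.Icc 1 n, cyclExp S n l ≤ S.card * n ^ 2 := by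
  have h : ∀ l ∈ Finset.Icc 1 n, cyclExp S n l ≤ n * S.card := fun l _ => by
    refine (Finset.sum_le_card_nsmul _ _ S.card fun i _ => Finset.card_filter_le _ _).trans ?_
    rw [Finset.card_range, smul_eq_mul]
  refine (Finset.sum_le_card_nsmul _ _ _ h).trans ?_
  rw [Nat.card_Icc, smul_eq_mul]
  exact le_of_eq (by rw [Nat.add_sub_cancel]; ring)

theorem summable_abs_log_norm_one_sub {p : ℂ} (hp : ‖p‖ < 1) :
    Summable fun m : ℕ => |Real.log ‖1 - p ^ m‖| := by
  have h : Summable fun m : ℕ => -p ^ m := (summable_geometric_of_norm_lt_one hp).neg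
  refine (Complex.summable_log_one_add_of_summable h).norm.of_nonneg_of_le
    (fun _ => abs_nonneg _) fun m => ?_
  rw [sub_eq_add_neg, ← Complex.log_re]
  exact Complex.abs_re_le_norm _

theorem exists_le_log_norm_cyclotomic {q : ℂ} (hq : 1 < ‖q‖) : ∃ B : ℝ, ∀ l : ℕ, 1 ≤ l →
    (cyclotomic l ℂ).eval q ≠ 0 ∧
      l.totient * Real.log ‖q‖ - B ≤ Real.log ‖(cyclotomic l ℂ).eval q‖ := by
  have hq0 : q ≠ 0 := fun h => by simp [h] at hq; linarith
  have hp : ‖q⁻¹‖ < 1 := by rw [norm_inv]; exact inv_lt_one_of_one_lt₀ hq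
  have hpow : ∀ m : ℕ, 0 < m → q ^ m - 1 ≠ 0 := by
    intro m hm h
    have h1 : ‖q‖ ^ m = 1 := by rw [← norm_pow, sub_eq_zero.1 h, norm_one]
    exact (one_lt_pow₀ hq hm.ne').ne' h1
  have hprod : ∀ m : ℕ, 0 < m → ∏ d ∈ m.divisors, (cyclotomic d ℂ).eval q = q ^ m - 1 := by
    intro m hm
    rw [← eval_prod, prod_cyclotomic_eq_X_pow_sub_one hm]
    simp
  have hne : ∀ l : ℕ, 0 < l → (cyclotomic l ℂ).eval q ≠ 0 := by
    intro l hl h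
    exact hpow l hl ((hprod l hl).symm.trans
      (Finset.prod_eq_zero (Nat.mem_divisors_self l hl.ne') h))
  have hsum := summable_abs_log_norm_one_sub hp
  refine ⟨∑' m : ℕ, |Real.log ‖1 - q⁻¹ ^ m‖|, fun l hl => ⟨hne l hl, ?_⟩⟩
  have hinv := (ArithmeticFunction.sum_eq_iff_sum_mul_moebius_eq
    (f := fun l => Real.log ‖(cyclotomic l ℂ).eval q‖ - l.totient * Real.log ‖q‖)
    (g := fun m => Real.log ‖1 - q⁻¹ ^ m‖)).1 (fun m hm => by
      rw [Finset.sum_sub_distrib, ← Finset.sum_mul, ← Nat.cast_sum, Nat.sum_totient,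
        ← Real.log_prod fun d hd => norm_ne_zero_iff.2 (hne d (Nat.pos_of_mem_divisors hd)),
        ← norm_prod, hprod m hm, ← Real.log_pow, ← norm_pow,
        ← Real.log_div (norm_ne_zero_iff.2 (hpow m hm)) (norm_ne_zero_iff.2 (pow_ne_zero _ hq0)),
        ← norm_div, sub_div, div_self (pow_ne_zero _ hq0), inv_pow, one_div]) l hl
  have hle : |∑ x ∈ l.divisorsAntidiagonal, ((ArithmeticFunction.moebius x.1 : ℤ) : ℝ) *
      Real.log ‖1 - q⁻¹ ^ x.2‖| ≤ ∑' m : ℕ, |Real.log ‖1 - q⁻¹ ^ m‖| := by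
    refine (Finset.abs_sum_le_sum_abs _ _).trans ?_
    have h1 : ∀ x ∈ l.divisorsAntidiagonal, |((ArithmeticFunction.moebius x.1 : ℤ) : ℝ) *
        Real.log ‖1 - q⁻¹ ^ x.2‖| ≤ |Real.log ‖1 - q⁻¹ ^ x.2‖| := by
      intro x _
      rw [abs_mul]
      refine mul_le_of_le_one_left (abs_nonneg _) ?_
      exact_mod_cast ArithmeticFunction.abs_moebius_le_one
    refine (Finset.sum_le_sum h1).trans ?_
    rw [Nat.sum_divisorsAntidiagonal' (fun _ m => |Real.log ‖1 - q⁻¹ ^ m‖|)]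
    exact hsum.sum_le_tsum _ fun _ _ => abs_nonneg _
  rw [hinv] at hle
  linarith [neg_le_of_abs_le hle]

theorem exists_le_log_norm_cyclDivisor {q : ℂ} (hq : 1 < ‖q‖) (S : Finset ℕ) :
    ∃ B : ℝ, ∀ n : ℕ, (cyclDivisor ℂ S n).eval q ≠ 0 ∧
      (cyclDivisor ℂ S n).natDegree * Real.log ‖q‖ - B * (n : ℝ) ^ 2 ≤
        Real.log ‖(cyclDivisor ℂ S n).eval q‖ := by
  obtain ⟨B, hB⟩ := exists_le_log_norm_cyclotomic hq
  have hq0 : q ≠ 0 := fun h => by simp [h] at hq; linarith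
  refine ⟨|B| * S.card, fun n => ?_⟩
  have hne : ∀ l ∈ Finset.Icc 1 n, (cyclotomic l ℂ).eval q ^ cyclExp S n l ≠ 0 := fun l hl =>
    pow_ne_zero _ (hB l (Finset.mem_Icc.1 hl).1).1
  have heval : (cyclDivisor ℂ S n).eval q = q ^ ((5 * n ^ 3 - 48 * n ^ 2) / 24) *
      ∏ l ∈ Finset.Icc 1 n, (cyclotomic l ℂ).eval q ^ cyclExp S n l := by
    rw [cyclDivisor, eval_mul, eval_prod]
    simp only [eval_pow, eval_X]
  refine ⟨?_, ?_⟩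
  · rw [heval]
    exact mul_ne_zero (pow_ne_zero _ hq0) (Finset.prod_ne_zero_iff.2 hne)
  · rw [heval, norm_mul, norm_prod, Real.log_mul (norm_ne_zero_iff.2 (pow_ne_zero _ hq0))
      (Finset.prod_ne_zero_iff.2 fun l hl => norm_ne_zero_iff.2 (hne l hl)),
      Real.log_prod fun l hl => norm_ne_zero_iff.2 (hne l hl), norm_pow, Real.log_pow,
      natDegree_cyclDivisor]
    have h1 : ∀ l ∈ Finset.Icc 1 n,
        (l.totient * cyclExp S n l : ℝ) * Real.log ‖q‖ - |B| * cyclExp S n l ≤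
          Real.log ‖(cyclotomic l ℂ).eval q ^ cyclExp S n l‖ := by
      intro l hl
      rw [norm_pow, Real.log_pow]
      have h2 := mul_le_mul_of_nonneg_left (hB l (Finset.mem_Icc.1 hl).1).2
        (Nat.cast_nonneg (α := ℝ) (cyclExp S n l))
      have h3 := mul_le_mul_of_nonneg_left (le_abs_self B)
        (Nat.cast_nonneg (α := ℝ) (cyclExp S n l))
      linarith
    have h2 := Finset.sum_le_sum h1
    rw [Finset.sum_sub_distrib, ← Finset.sum_mul, ← Finset.mul_sum] at h2
    have h3 : ∑ l ∈ Finset.Icc 1 n, (cyclExp S n l : ℝ) ≤ S.card * (n : ℝ) ^ 2 := by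
      exact_mod_cast sum_cyclExp_le S n
    have h4 := mul_le_mul_of_nonneg_left h3 (abs_nonneg B)
    push_cast
    linarith

end DivisorSize

section Parameters
open Filter Topology

theorem sin_two_pi_mul_div_three (n : ℕ) : Real.sin (2 * Real.pi * n / 3) =
    Real.sqrt 3 / 2 * (if n % 3 = 1 then 1 else if n % 3 = 2 then -1 else 0) := by
  have h1 : Real.sin (2 * Real.pi / 3) = Real.sqrt 3 / 2 := by
    rw [show 2 * Real.pi / 3 = Real.pi - Real.pi / 3 by ring, Real.sin_pi_sub, Real.sin_pi_div_three]
  have h2 : Real.sin (2 * Real.pi * 2 / 3) = -(Real.sqrt 3 / 2) := by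
    rw [show 2 * Real.pi * 2 / 3 = Real.pi / 3 + Real.pi by ring, Real.sin_add_pi,
      Real.sin_pi_div_three]
  have h3 : Real.sin (2 * Real.pi * n / 3) = Real.sin (2 * Real.pi * (n % 3 : ℕ) / 3) := by
    have : (n : ℝ) = (n % 3 : ℕ) + 3 * (n / 3 : ℕ) := by exact_mod_cast (Nat.mod_add_div n 3).symm
    rw [this, show 2 * Real.pi * ((n % 3 : ℕ) + 3 * (n / 3 : ℕ) : ℝ) / 3 =
      2 * Real.pi * (n % 3 : ℕ) / 3 + (n / 3 : ℕ) * (2 * Real.pi) by ring,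
      Real.sin_add_nat_mul_two_pi]
  rw [h3]
  have : n % 3 < 3 := Nat.mod_lt _ (by norm_num)
  interval_cases n % 3
  · simp
  · simp [h1]
  · simp [h2]

theorem hasSum_mod_three {L : ℝ}
    (hL : L = ∑' n : ℕ, Real.sin (2 * Real.pi * (n + 1) / 3) / ((n : ℝ) + 1) ^ 2) :
    HasSum (fun n : ℕ => if n % 3 ≠ 1 then 1 / (n : ℝ) ^ 2 else 0)
      (5 * Real.pi ^ 2 / 54 - Real.sqrt 3 * L / 3) := by
  have hs3 : Real.sqrt 3 * Real.sqrt 3 = 3 := Real.mul_self_sqrt (by norm_num)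
  have h3 : HasSum (fun n : ℕ => if n % 3 = 0 then 1 / (n : ℝ) ^ 2 else 0) (Real.pi ^ 2 / 54) := by
    have hinj : Function.Injective fun m : ℕ => 3 * m := fun a b h => by
      simpa using h
    rw [← hinj.hasSum_iff]
    · convert! hasSum_zeta_two.mul_right (1 / 9) using 1
      · ext m
        simp only [Function.comp, Nat.mul_mod_right, if_true]
        push_cast
        rw [mul_pow, div_mul_div_comm]
        norm_num [mul_comm]
      · ring
    · intro n hn
      rw [if_neg]
      exact fun h => hn ⟨n / 3, Nat.mul_div_cancel' (Nat.dvd_of_mod_eq_zero h)⟩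
  have hsin : Summable fun n : ℕ => Real.sin (2 * Real.pi * n / 3) / (n : ℝ) ^ 2 := by
    refine Summable.of_norm_bounded (g := fun n : ℕ => 1 / (n : ℝ) ^ 2) hasSum_zeta_two.summable
      fun n => ?_
    rw [norm_div, Real.norm_eq_abs, Real.norm_of_nonneg (by positivity)]
    gcongr
    exact Real.abs_sin_le_one _
  have hL' : HasSum (fun n : ℕ => Real.sin (2 * Real.pi * n / 3) / (n : ℝ) ^ 2) L := by
    rw [hsin.hasSum_iff, hsin.tsum_eq_zero_add, hL]
    simp
  have h := ((hasSum_zeta_two.mul_right (1 / 2)).add (h3.mul_right (1 / 2))).sub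
    (hL'.mul_left (Real.sqrt 3 / 3))
  convert! h using 1
  · ext n
    rw [sin_two_pi_mul_div_three]
    have h4 : Real.sqrt 3 / 3 * (Real.sqrt 3 / 2) = 1 / 2 := by linear_combination hs3 / 6
    rw [mul_div_assoc, ← mul_assoc, h4]
    have : n % 3 < 3 := Nat.mod_lt _ (by norm_num)
    interval_cases n % 3 <;> norm_num <;> ring
  · ring

theorem exists_parameters {L : ℝ}
    (hL : L = ∑' n : ℕ, Real.sin (2 * Real.pi * (n + 1) / 3) / ((n : ℝ) + 1) ^ 2) {u v : ℝ}
    (h : v > 126 * Real.pi ^ 2 / (47 * Real.pi ^ 2 - 72 * Real.sqrt 3 * L) * u) :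
    ∃ (κ : ℝ) (S : Finset ℕ), 0 ≤ κ ∧ κ < 3 / Real.pi ^ 2 ∧ (∀ s ∈ S, 1 ≤ s ∧ s % 3 ≠ 1) ∧
      7 / 6 * u < (2 * (5 / 24 + κ / 3 * ∑ s ∈ S, 1 / (s : ℝ) ^ 2) - 1 / 6) * v := by
  have hsum := hasSum_mod_three hL
  have hpi : 0 < Real.pi ^ 2 := by positivity
  have hT : 0 < 47 * Real.pi ^ 2 - 72 * Real.sqrt 3 * L := by
    have := hsum.nonneg fun n => by split_ifs <;> positivity
    linarith
  rw [gt_iff_lt, div_mul_eq_mul_div, div_lt_iff₀ hT] at h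
  have h1 : Tendsto (fun k : ℕ => 3 / Real.pi ^ 2 * (1 - 1 / ((k : ℝ) + 1))) atTop
      (𝓝 (3 / Real.pi ^ 2 * (1 - 0))) :=
    (tendsto_const_nhds.sub tendsto_one_div_add_atTop_nhds_zero_nat).const_mul _
  have h2 := hsum.tendsto_sum_nat
  have h3 := ((((((h1.div_const 3).mul h2).const_add (5 / 24)).const_mul 2).sub_const
    (1 / 6)).mul_const v)
  have hlim : 7 / 6 * u < (2 * (5 / 24 + 3 / Real.pi ^ 2 * (1 - 0) / 3 *
      (5 * Real.pi ^ 2 / 54 - Real.sqrt 3 * L / 3)) - 1 / 6) * v := by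
    have h4 : (2 * (5 / 24 + 3 / Real.pi ^ 2 * (1 - 0) / 3 *
        (5 * Real.pi ^ 2 / 54 - Real.sqrt 3 * L / 3)) - 1 / 6) * v =
        v * (47 * Real.pi ^ 2 - 72 * Real.sqrt 3 * L) / (108 * Real.pi ^ 2) := by
      field_simp
      ring
    rw [h4, lt_div_iff₀ (by positivity)]
    linarith
  obtain ⟨k, hk⟩ := (h3.eventually_const_lt hlim).exists
  have hk1 : (0 : ℝ) < 1 / ((k : ℝ) + 1) := by positivity
  have hk2 : 1 / ((k : ℝ) + 1) ≤ 1 := by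
    rw [div_le_one (by positivity)]
    linarith [(Nat.cast_nonneg k : (0 : ℝ) ≤ k)]
  refine ⟨3 / Real.pi ^ 2 * (1 - 1 / ((k : ℝ) + 1)), (Finset.range k).filter fun s => 1 ≤ s ∧ s % 3 ≠ 1,
    mul_nonneg (by positivity) (sub_nonneg.2 hk2), ?_, fun s hs => (Finset.mem_filter.1 hs).2, ?_⟩
  · exact mul_lt_of_lt_one_right (by positivity) (by linarith)
  · suffices hS : ∑ s ∈ (Finset.range k).filter fun s => 1 ≤ s ∧ s % 3 ≠ 1, 1 / (s : ℝ) ^ 2 =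
        ∑ s ∈ Finset.range k, if s % 3 ≠ 1 then 1 / (s : ℝ) ^ 2 else 0 by rwa [hS]
    rw [Finset.sum_filter]
    refine Finset.sum_congr rfl fun s _ => ?_
    rcases Nat.eq_zero_or_pos s with rfl | hs
    · simp
    · simp [Nat.succ_le_of_lt hs]

end Parameters

section Kronecker

open Polynomial

/-- The Hankel determinants of a sequence. -/
noncomputable def hankelDet {A : Type*} [CommRing A] (w : ℕ → A) (n : ℕ) : A :=
  (Matrix.of fun i j : Fin n => w (i + j)).det

variable {F : Type*} [Field F] {w : ℕ → F}

theorem seqFunctional_mul_eq_sum (w : ℕ → F) (P : F[X]) {s : F[X]} {n : ℕ} (hs : s.natDegree < n) :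
    seqFunctional w (P * s) = ∑ j ∈ Finset.range n, s.coeff j * seqFunctional w (P * X ^ j) := by
  conv_lhs => rw [as_sum_range_C_mul_X_pow' s hs, Finset.mul_sum, map_sum]
  refine Finset.sum_congr rfl fun j _ => ?_
  rw [mul_left_comm, seqFunctional_C_mul]

theorem hankel_mulVec (w : ℕ → F) {r : F[X]} {n : ℕ} (hr : r.natDegree < n) (i : Fin n) :
    (Matrix.of fun i j : Fin n => w (i + j)).mulVec (fun j => r.coeff j) i =
      seqFunctional w (r * X ^ (i : ℕ)) := by
  rw [mul_comm, seqFunctional_mul_eq_sum w _ hr,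
    ← Fin.sum_univ_eq_sum_range fun j => r.coeff j * seqFunctional w (X ^ (i : ℕ) * X ^ j)]
  simp only [Matrix.mulVec, dotProduct, Matrix.of_apply, ← pow_add, seqFunctional_X_pow]
  exact Finset.sum_congr rfl fun j _ => mul_comm _ _

theorem eq_zero_of_hankelDet_ne_zero {n : ℕ} (hn : hankelDet w n ≠ 0) {r : F[X]}
    (hr : r.degree < n) (h : ∀ i < n, seqFunctional w (r * X ^ i) = 0) : r = 0 := by
  by_contra h0
  have hr' : r.natDegree < n := (natDegree_lt_iff_degree_lt h0).2 hr
  have h1 : (fun j : Fin n => r.coeff j) = 0 :=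
    Matrix.eq_zero_of_mulVec_eq_zero hn (funext fun i => by
      rw [hankel_mulVec w hr']
      exact h i i.2)
  have h2 := congrFun h1 ⟨r.natDegree, hr'⟩
  exact h0 (leadingCoeff_eq_zero.1 h2)

theorem exists_of_hankelDet_eq_zero {n : ℕ} (hn : hankelDet w (n + 1) = 0) :
    ∃ r : F[X], r ≠ 0 ∧ r.natDegree ≤ n ∧ ∀ i ≤ n, seqFunctional w (r * X ^ i) = 0 := by
  obtain ⟨c, hc, h⟩ := Matrix.exists_mulVec_eq_zero_iff.2 hn
  set r : F[X] := ∑ j : Fin (n + 1), C (c j) * X ^ (j : ℕ) with hr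
  have hcoeff : ∀ j : Fin (n + 1), r.coeff j = c j := by
    intro j
    rw [hr, finsetSum_coeff, Finset.sum_eq_single j]
    · simp
    · intro k _ hk
      rw [coeff_C_mul_X_pow, if_neg]
      exact fun h => hk (Fin.ext h.symm)
    · simp
  have hdeg : r.natDegree ≤ n := natDegree_sum_le_of_forall_le _ _ fun j _ =>
    (natDegree_C_mul_X_pow_le _ _).trans (Nat.le_of_lt_succ j.2)
  refine ⟨r, fun h0 => hc ?_, hdeg, fun i hi => ?_⟩
  · ext j
    rw [← hcoeff, h0, coeff_zero, Pi.zero_apply]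
  · have h1 := hankel_mulVec w (Nat.lt_succ_of_le hdeg) ⟨i, Nat.lt_succ_of_le hi⟩
    simp only [hcoeff] at h1
    rw [← h1]
    exact congrFun h ⟨i, _⟩

theorem exists_annihilator {N : ℕ} (hN : hankelDet w N ≠ 0)
    (h : ∀ n, N < n → hankelDet w n = 0) :
    ∃ P : F[X], P ≠ 0 ∧ ∀ j, seqFunctional w (P * X ^ j) = 0 := by
  obtain ⟨P, hP0, hPdeg, hP⟩ := exists_of_hankelDet_eq_zero (h (N + 1) (Nat.lt_succ_self N))
  have hdeg : P.natDegree = N := by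
    refine le_antisymm hPdeg (not_lt.1 fun hlt => hP0 ?_)
    exact eq_zero_of_hankelDet_ne_zero hN ((natDegree_lt_iff_degree_lt hP0).1 hlt)
      fun i hi => hP i hi.le
  refine ⟨P, hP0, fun j => ?_⟩
  induction j using Nat.strong_induction_on with
  | _ M ih =>
    rcases le_or_gt M N with hM | hM
    · exact hP M hM
    have hvan : ∀ s : F[X], s.natDegree < M → seqFunctional w (P * s) = 0 := fun s hs => by
      rw [seqFunctional_mul_eq_sum w P hs]
      exact Finset.sum_eq_zero fun j hj => by rw [ih j (Finset.mem_range.1 hj), mul_zero]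
    obtain ⟨r, hr0, hrdeg, hr⟩ := exists_of_hankelDet_eq_zero (h (M + 1) (by omega))
    have hdiv := EuclideanDomain.div_add_mod r P
    have hmodlt : (r % P).degree < P.degree := EuclideanDomain.mod_lt r hP0
    generalize r / P = s at hdiv
    generalize r % P = t at hdiv hmodlt
    have hsN : s ≠ 0 → N + s.natDegree ≤ M := fun hs => by
      rw [← hdeg, ← natDegree_mul hP0 hs, eq_sub_of_add_eq hdiv]
      have := natDegree_le_natDegree hmodlt.le
      exact (natDegree_sub_le _ _).trans (max_le hrdeg (by omega))
    have hmod : t = 0 := by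
      refine eq_zero_of_hankelDet_ne_zero hN ?_ fun i hi => ?_
      · rw [← hdeg, ← degree_eq_natDegree hP0]
        exact hmodlt
      · have h1 : t * X ^ i = r * X ^ i - P * (s * X ^ i) := by
          linear_combination X ^ i * hdiv
        rw [h1, map_sub, hr i (by omega), hvan, sub_zero]
        rcases eq_or_ne s 0 with h0 | h0
        · rw [h0, zero_mul, natDegree_zero]
          omega
        · rw [natDegree_mul_X_pow _ h0]
          have := hsN h0
          omega
    rw [hmod, add_zero] at hdiv
    have hs0 : s ≠ 0 := fun h0 => hr0 (by rw [← hdiv, h0, mul_zero])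
    have hsdeg : s.natDegree ≤ M := (Nat.le_add_left _ _).trans (hsN hs0)
    have h2 := hr (M - s.natDegree) (Nat.sub_le _ _)
    rw [← hdiv, mul_assoc] at h2
    have hd : (s * X ^ (M - s.natDegree)).natDegree = M := by
      rw [natDegree_mul_X_pow _ hs0]
      omega
    rw [seqFunctional_mul_eq_sum w P (hd.trans_lt (Nat.lt_succ_self M)), Finset.sum_range_succ,
      Finset.sum_eq_zero fun j hj => by rw [ih j (Finset.mem_range.1 hj), mul_zero], zero_add] at h2
    refine (mul_eq_zero.1 h2).resolve_left ?_
    have h3 := leadingCoeff_ne_zero.2 (mul_ne_zero hs0 (pow_ne_zero (M - s.natDegree)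
      (X_ne_zero (R := F))))
    rwa [leadingCoeff, hd] at h3

end Kronecker

section Moments

open Polynomial

variable {A z w : ℕ → ℂ} {Z : ℝ}

theorem hasSum_seqFunctional (hA : Summable fun k => ‖A k‖) (hz : ∀ k, ‖z k‖ ≤ Z)
    (hw : ∀ n, w n = ∑' k, A k * z k ^ n) (P : ℂ[X]) :
    HasSum (fun k => A k * P.eval (z k)) (seqFunctional w P) := by
  induction P using Polynomial.induction_on' with
  | add P Q hP hQ =>
    rw [map_add]
    simpa only [eval_add, mul_add] using hP.add hQ
  | monomial n c =>
    have hs : Summable fun k => A k * z k ^ n := by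
      refine Summable.of_norm_bounded (hA.mul_right (Z ^ n)) fun k => ?_
      rw [norm_mul, norm_pow]
      gcongr
      exact hz k
    rw [← C_mul_X_pow_eq_monomial, seqFunctional_C_mul, seqFunctional_X_pow, hw]
    convert! hs.hasSum.mul_left c using 2
    simp
    ring

theorem exists_hankelDet_ne_zero (hA : Summable fun k => ‖A k‖) (hA0 : ∀ k, A k ≠ 0)
    (hz0 : ∀ k, z k ≠ 0) (hz : StrictAnti fun k => ‖z k‖) (hw : ∀ n, w n = ∑' k, A k * z k ^ n)
    (N : ℕ) : ∃ n, N ≤ n ∧ hankelDet w n ≠ 0 := by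
  by_contra! hcon
  have hex : ∃ M, hankelDet w M ≠ 0 ∧ ∀ n, M < n → hankelDet w n = 0 := by
    classical
    refine ⟨Nat.findGreatest (fun n => hankelDet w n ≠ 0) N, ?_, fun n hn => ?_⟩
    · exact Nat.findGreatest_spec (P := fun n => hankelDet w n ≠ 0) (Nat.zero_le N)
        (by simp [hankelDet])
    · rcases le_total N n with h | h
      · exact hcon n h
      · exact not_not.1 (Nat.findGreatest_is_greatest hn h)
  obtain ⟨M, hM, hM'⟩ := hex
  obtain ⟨P, hP0, hP⟩ := exists_annihilator hM hM'
  have hzZ : ∀ k, ‖z k‖ ≤ ‖z 0‖ := fun k => hz.antitone (Nat.zero_le k)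
  have hroot : ∃ k, P.eval (z k) ≠ 0 := by
    by_contra! h
    have hinj : Function.Injective z := fun i j hij => hz.injective (congrArg norm hij)
    exact hP0 (Polynomial.eq_zero_of_infinite_isRoot P
      ((Set.infinite_range_of_injective hinj).mono (by rintro _ ⟨k, rfl⟩; exact h k)))
  classical
  obtain ⟨k₀, hk₀, hmin⟩ : ∃ k, P.eval (z k) ≠ 0 ∧ ∀ j < k, P.eval (z j) = 0 :=
    ⟨Nat.find hroot, Nat.find_spec hroot, fun j hj => not_not.1 (Nat.find_min hroot hj)⟩
  have hBs : Summable fun k => ‖A k * P.eval (z k)‖ :=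
    (hasSum_seqFunctional hA hzZ hw P).summable.norm
  have hpos : ∀ k, 0 < ‖z k‖ := fun k => norm_pos_iff.2 (hz0 k)
  have hbound : ∀ j : ℕ, ‖A k₀ * P.eval (z k₀)‖ ≤
      (∑' k, ‖A k * P.eval (z k)‖) * (‖z (k₀ + 1)‖ / ‖z k₀‖) ^ j := by
    intro j
    have h1 := hasSum_seqFunctional hA hzZ hw (P * X ^ j)
    rw [hP] at h1
    have h2 := (hasSum_ite_sub_hasSum h1 k₀)
    rw [zero_sub] at h2
    have h3 := h2.norm_le_of_bounded (hBs.hasSum.mul_right (‖z (k₀ + 1)‖ ^ j)) fun k => by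
      rcases lt_trichotomy k k₀ with h | h | h
      · simp [hmin k h]
      · rw [if_pos h, norm_zero]
        positivity
      · rw [if_neg h.ne', eval_mul, eval_pow, eval_X, ← mul_assoc, norm_mul, norm_pow]
        gcongr
        exact hz.antitone h
    rw [norm_neg, eval_mul, eval_pow, eval_X, ← mul_assoc, norm_mul, norm_pow] at h3
    rwa [div_pow, ← mul_div_assoc, le_div_iff₀ (pow_pos (hpos _) _)]
  have hlim : Filter.Tendsto (fun j : ℕ => (∑' k, ‖A k * P.eval (z k)‖) *
      (‖z (k₀ + 1)‖ / ‖z k₀‖) ^ j) Filter.atTop (nhds 0) := by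
    have := (tendsto_pow_atTop_nhds_zero_of_lt_one (div_nonneg (norm_nonneg _) (norm_nonneg _))
      ((div_lt_one (hpos k₀)).2 (hz (Nat.lt_succ_self k₀)))).const_mul
        (∑' k, ‖A k * P.eval (z k)‖)
    rwa [mul_zero] at this
  have := ge_of_tendsto' hlim hbound
  exact mul_ne_zero (hA0 k₀) hk₀ (norm_le_zero_iff.1 this)

end Moments

section GaussianDet

open Polynomial

theorem sum_range_quadratic (K₀ K₁ s : ℝ) (n : ℕ) :
    ∑ i ∈ Finset.range n, (K₀ + K₁ * i + s * (i : ℝ) ^ 2) =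
      K₀ * n + K₁ * (n * (n - 1) / 2) + s * ((n : ℝ) ^ 3 / 3 - (n : ℝ) ^ 2 / 2 + n / 6) := by
  induction n with
  | zero => simp
  | succ n ih =>
    rw [Finset.sum_range_succ, ih]
    push_cast
    ring

theorem natCast_factorial_le_exp (n : ℕ) : (n.factorial : ℝ) ≤ Real.exp ((n : ℝ) ^ 2) := by
  calc (n.factorial : ℝ) ≤ (n : ℝ) ^ n := by exact_mod_cast Nat.factorial_le_pow n
    _ ≤ Real.exp n ^ n := by
        gcongr
        linarith [Real.add_one_le_exp (n : ℝ)]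
    _ = Real.exp ((n : ℝ) ^ 2) := by rw [← Real.exp_nat_mul, sq]

theorem exists_norm_det_le_exp (K₀ K₁ s : ℝ) : ∃ B : ℝ, ∀ (n : ℕ) (M : Matrix (Fin n) (Fin n) ℂ),
    (∀ i j, ‖M i j‖ ≤ Real.exp ((K₀ + K₁ * (i : ℕ) + s * ((i : ℕ) : ℝ) ^ 2) +
      (K₀ + K₁ * (j : ℕ) + s * ((j : ℕ) : ℝ) ^ 2))) →
    ‖M.det‖ ≤ Real.exp (2 / 3 * s * (n : ℝ) ^ 3 + B * (n : ℝ) ^ 2) := by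
  refine ⟨1 + 2 * |K₀| + |K₁| + 4 / 3 * |s|, fun n M hM => ?_⟩
  have h := norm_det_le M (fun i => K₀ + K₁ * (i : ℕ) + s * ((i : ℕ) : ℝ) ^ 2)
    (fun i => K₀ + K₁ * (i : ℕ) + s * ((i : ℕ) : ℝ) ^ 2) hM
  refine h.trans ((mul_le_mul_of_nonneg_right (natCast_factorial_le_exp n)
    (Real.exp_pos _).le).trans ?_)
  rw [← Real.exp_add, Real.exp_le_exp, Finset.sum_add_distrib,
    Fin.sum_univ_eq_sum_range (fun i => K₀ + K₁ * (i : ℝ) + s * (i : ℝ) ^ 2), sum_range_quadratic]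
  have hn : (n : ℝ) ≤ (n : ℝ) ^ 2 := by exact_mod_cast Nat.le_self_pow two_ne_zero n
  have hn0 : (0 : ℝ) ≤ n := Nat.cast_nonneg n
  have h0 : K₀ * n ≤ |K₀| * (n : ℝ) ^ 2 :=
    mul_le_mul (le_abs_self _) hn hn0 (abs_nonneg _)
  have h1 : K₁ * (n * (n - 1) / 2) ≤ |K₁| * ((n : ℝ) ^ 2 / 2) :=
    mul_le_mul (le_abs_self _) (by linarith [hn, hn0, sq (n : ℝ)]) (by nlinarith) (abs_nonneg _)
  have h2 : -s * ((n : ℝ) ^ 2 / 2 - n / 6) ≤ |s| * ((n : ℝ) ^ 2 * (2 / 3)) :=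
    mul_le_mul (neg_le_abs s) (by nlinarith) (by nlinarith) (abs_nonneg _)
  linarith

end GaussianDet

section Growth

open Polynomial

variable {q : ℂ}

theorem norm_tschSeq_le (hq : 1 < ‖q‖) (d c a b : ℂ) (m : ℕ) :
    ‖tschSeq q d c a b m‖ ≤
      (1 + ‖a‖ + ‖b‖ + ‖c‖ + ‖d‖) ^ (m + 1) * ‖q‖ ^ (m * (m + 1) / 2) := by
  set E := 1 + ‖a‖ + ‖b‖ + ‖c‖ + ‖d‖ with hE
  have ha := norm_nonneg a
  have hb := norm_nonneg b
  have hc := norm_nonneg c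
  have hd := norm_nonneg d
  have hE1 : 1 ≤ E := by linarith
  induction m with
  | zero =>
    simp only [tschSeq]
    simp
    linarith
  | succ m ih =>
    have hX : 1 ≤ ‖q‖ ^ (m * (m + 1) / 2) := one_le_pow₀ hq.le
    have hexp : (m + 1) * (m + 1 + 1) / 2 = m * (m + 1) / 2 + (m + 1) := by
      rw [show (m + 1) * (m + 1 + 1) = m * (m + 1) + (m + 1) * 2 by ring,
        Nat.add_mul_div_right _ _ two_pos]
    simp only [tschSeq]
    rw [hexp, norm_mul, norm_pow, pow_add ‖q‖ (m * (m + 1) / 2), pow_succ E, ← mul_assoc, mul_comm]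
    gcongr
    set X := ‖q‖ ^ (m * (m + 1) / 2) with hXd
    have hEm : ‖a‖ ^ m ≤ E ^ (m + 1) :=
      (pow_le_pow_left₀ ha (by linarith) m).trans (pow_le_pow_right₀ hE1 (Nat.le_succ m))
    calc ‖d * tschSeq q d c a b m - c * a ^ m‖
        ≤ ‖d‖ * ‖tschSeq q d c a b m‖ + ‖c‖ * ‖a‖ ^ m := by
          refine (norm_sub_le _ _).trans ?_
          rw [norm_mul, norm_mul, norm_pow]
      _ ≤ ‖d‖ * (E ^ (m + 1) * X) + ‖c‖ * (E ^ (m + 1) * X) := by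
          gcongr
          exact hEm.trans (le_mul_of_one_le_right (by positivity) hX)
      _ = E ^ (m + 1) * X * (‖c‖ + ‖d‖) := by ring
      _ ≤ E ^ (m + 1) * X * E := by
          gcongr
          linarith
      _ = E ^ (m + 1) * E * X := by ring

theorem exists_norm_hankelDet_tschSeq_le (hq : 1 < ‖q‖) (d c a b : ℂ) : ∃ B : ℝ, ∀ n : ℕ,
    ‖hankelDet (tschSeq q d c a b) n‖ ≤
      Real.exp (2 / 3 * Real.log ‖q‖ * (n : ℝ) ^ 3 + B * (n : ℝ) ^ 2) := by
  set E := 1 + ‖a‖ + ‖b‖ + ‖c‖ + ‖d‖ with hE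
  have hE1 : 1 ≤ E := by
    have ha := norm_nonneg a
    have hb := norm_nonneg b
    have hc := norm_nonneg c
    have hd := norm_nonneg d
    linarith
  obtain ⟨B, hB⟩ := exists_norm_det_le_exp (Real.log E / 2) (Real.log E + Real.log ‖q‖)
    (Real.log ‖q‖)
  refine ⟨B, fun n => hB n _ fun i j => (norm_tschSeq_le hq d c a b (i + j)).trans ?_⟩
  have hq0 : 0 < ‖q‖ := by linarith
  rw [← hE]
  nth_rewrite 1 [← Real.exp_log (by linarith : 0 < E)]
  nth_rewrite 1 [← Real.exp_log hq0]
  rw [← Real.exp_nat_mul, ← Real.exp_nat_mul, ← Real.exp_add, Real.exp_le_exp]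
  have hexp : (((i : ℕ) + j) * ((i : ℕ) + j + 1) / 2) ≤ (i : ℕ) ^ 2 + i + ((j : ℕ) ^ 2 + j) := by
    rw [Nat.div_le_iff_le_mul_add_pred two_pos]
    zify
    nlinarith [sq_nonneg ((i : ℤ) - j)]
  have hexp' : ((((i : ℕ) + j) * ((i : ℕ) + j + 1) / 2 : ℕ) : ℝ) ≤
      ((i : ℕ) : ℝ) ^ 2 + (i : ℕ) + (((j : ℕ) : ℝ) ^ 2 + (j : ℕ)) := by exact_mod_cast hexp
  have := mul_le_mul_of_nonneg_right hexp' (Real.log_pos hq).le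
  push_cast
  linarith

end Growth

section Decay

open Polynomial

variable {q α : ℂ}

/-- The terms of the Tschakaloff series. -/
noncomputable def tschTerm (q α : ℂ) (k : ℕ) : ℂ := α ^ k / q ^ (k * (k + 1) / 2)

theorem norm_tschTerm_le (hq : 1 < ‖q‖) (hα : α ≠ 0) (k : ℕ) :
    ‖tschTerm q α k‖ ≤
      Real.exp (|Real.log ‖α‖| * k - Real.log ‖q‖ * (k : ℝ) ^ 2 / 2) := by
  have hq0 : 0 < ‖q‖ := by linarith
  have hk : ((k * (k + 1) / 2 : ℕ) : ℝ) = (k : ℝ) * (k + 1) / 2 := by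
    rw [Nat.cast_div (Nat.even_mul_succ_self k).two_dvd (by norm_num)]
    push_cast
    ring
  rw [tschTerm, norm_div, norm_pow, norm_pow]
  nth_rewrite 1 [← Real.exp_log (norm_pos_iff.2 hα)]
  nth_rewrite 1 [← Real.exp_log hq0]
  rw [← Real.exp_nat_mul, ← Real.exp_nat_mul, ← Real.exp_sub, Real.exp_le_exp, hk]
  have h1 := mul_le_mul_of_nonneg_left (le_abs_self (Real.log ‖α‖)) (Nat.cast_nonneg (α := ℝ) k)
  have h2 := mul_nonneg (Nat.cast_nonneg (α := ℝ) k) (Real.log_pos hq).le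
  linarith

theorem sub_sq_le_of_le {c l k m : ℝ} (hl : 0 < l) (hm : 0 ≤ m) (hk : m ≤ k) :
    c * k - l * k ^ 2 / 2 ≤ (c + 1) * m - l * m ^ 2 / 2 + (c + 1) ^ 2 / (2 * l) - k := by
  have h1 : 0 ≤ (l * (k - m) - (c + 1)) ^ 2 / (2 * l) := by positivity
  have h2 : (l * (k - m) - (c + 1)) ^ 2 / (2 * l) =
      l * (k - m) ^ 2 / 2 - (c + 1) * (k - m) + (c + 1) ^ 2 / (2 * l) := by
    field_simp
    ring
  have h3 : 0 ≤ l * (m * (k - m)) := by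
    have := sub_nonneg.2 hk
    positivity
  linarith

theorem summable_exp_neg_natCast : Summable fun k : ℕ => Real.exp (-(k : ℝ)) := by
  have := summable_geometric_of_lt_one (Real.exp_pos (-1)).le (Real.exp_lt_one_iff.2 (by norm_num))
  refine this.congr fun k => ?_
  rw [← Real.exp_nat_mul, mul_neg_one]

theorem summable_norm_tschTerm (hq : 1 < ‖q‖) (hα : α ≠ 0) :
    Summable fun k => ‖tschTerm q α k‖ := by
  refine Summable.of_nonneg_of_le (fun k => norm_nonneg _) (fun k => ?_)
    (summable_exp_neg_natCast.mul_left
      (Real.exp ((|Real.log ‖α‖| + 1) ^ 2 / (2 * Real.log ‖q‖))))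
  refine (norm_tschTerm_le hq hα k).trans ?_
  rw [← Real.exp_add, Real.exp_le_exp]
  have := sub_sq_le_of_le (c := |Real.log ‖α‖|) (Real.log_pos hq) le_rfl (Nat.cast_nonneg (α := ℝ) k)
  linarith

theorem tsum_tschTerm_mul_pow (hq : 1 < ‖q‖) (hα : α ≠ 0) (n : ℕ) :
    ∑' k, tschTerm q α k / q ^ (k * n) =
      1 + α / q ^ (n + 1) * ∑' k, tschTerm q α k / q ^ (k * (n + 1)) := by
  have hq0 : q ≠ 0 := norm_pos_iff.1 (by linarith)
  have hs : Summable fun k => tschTerm q α k / q ^ (k * n) := by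
    refine Summable.of_norm_bounded (summable_norm_tschTerm hq hα) fun k => ?_
    rw [norm_div, norm_pow]
    exact div_le_self (norm_nonneg _) (one_le_pow₀ hq.le)
  rw [hs.tsum_eq_zero_add, ← tsum_mul_left]
  congr 1
  · simp [tschTerm]
  · refine tsum_congr fun k => ?_
    have hexp : (k + 1) * (k + 1 + 1) / 2 = k * (k + 1) / 2 + (k + 1) := by
      rw [show (k + 1) * (k + 1 + 1) = k * (k + 1) + (k + 1) * 2 by ring,
        Nat.add_mul_div_right _ _ two_pos]
    rw [tschTerm, tschTerm, hexp]
    generalize k * (k + 1) / 2 = e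
    field_simp
    ring

theorem tschSeq_eq_tsum (hq : 1 < ‖q‖) (hα : α ≠ 0) (d : ℂ) (n : ℕ) :
    tschSeq q d (d ^ 2) (d * α) (d * ∑' k, tschTerm q α k) n =
      ∑' k, d * tschTerm q α k * (d * α / q ^ k) ^ n := by
  have hq0 : q ≠ 0 := norm_pos_iff.1 (by linarith)
  have key : tschSeq q d (d ^ 2) (d * α) (d * ∑' k, tschTerm q α k) n =
      d * (d * α) ^ n * ∑' k, tschTerm q α k / q ^ (k * n) := by
    induction n with
    | zero => simp [tschSeq]
    | succ n ih =>
      simp only [tschSeq]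
      rw [ih, tsum_tschTerm_mul_pow hq hα n]
      field_simp
      ring
  rw [key, ← tsum_mul_left]
  refine tsum_congr fun k => ?_
  rw [div_pow, ← pow_mul]
  ring

theorem exists_hankelDet_tschSeq_ne_zero (hq : 1 < ‖q‖) (hα : α ≠ 0) {d : ℂ} (hd : d ≠ 0) (N : ℕ) :
    ∃ n, N ≤ n ∧ hankelDet (tschSeq q d (d ^ 2) (d * α) (d * ∑' k, tschTerm q α k)) n ≠ 0 := by
  have hq0 : q ≠ 0 := norm_pos_iff.1 (by linarith)
  refine exists_hankelDet_ne_zero (A := fun k => d * tschTerm q α k) (z := fun k => d * α / q ^ k)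
    ?_ (fun k => ?_) (fun k => ?_) ?_ (tschSeq_eq_tsum hq hα d) N
  · simpa only [norm_mul] using (summable_norm_tschTerm hq hα).mul_left ‖d‖
  · exact mul_ne_zero hd (div_ne_zero (pow_ne_zero _ hα) (pow_ne_zero _ hq0))
  · exact div_ne_zero (mul_ne_zero hd hα) (pow_ne_zero _ hq0)
  · refine strictAnti_nat_of_succ_lt fun k => ?_
    simp only [norm_div, norm_pow]
    exact div_lt_div_of_pos_left (norm_pos_iff.2 (mul_ne_zero hd hα)) (pow_pos (by linarith) _)
      (pow_lt_pow_right₀ hq (Nat.lt_succ_self k))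

/-- The monic polynomial with roots `γ / q ^ s`, `s < i`. -/
noncomputable def nodePoly (q γ : ℂ) (i : ℕ) : ℂ[X] :=
  ∏ s ∈ Finset.range i, (X - C (γ / q ^ s))

theorem nodePoly_monic (q γ : ℂ) (i : ℕ) : (nodePoly q γ i).Monic :=
  monic_prod_of_monic _ _ fun _ _ => monic_X_sub_C _

theorem natDegree_nodePoly (q γ : ℂ) (i : ℕ) : (nodePoly q γ i).natDegree = i := by
  rw [nodePoly, natDegree_prod_of_monic _ _ fun _ _ => monic_X_sub_C _]
  simp

theorem eval_nodePoly_eq_zero (q γ : ℂ) {i k : ℕ} (h : k < i) :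
    (nodePoly q γ i).eval (γ / q ^ k) = 0 := by
  rw [nodePoly, eval_prod]
  exact Finset.prod_eq_zero (Finset.mem_range.2 h) (by simp)

theorem norm_eval_nodePoly_le (hq : 1 < ‖q‖) {γ : ℂ} (hγ : γ ≠ 0) {i k : ℕ} (h : i ≤ k) :
    ‖(nodePoly q γ i).eval (γ / q ^ k)‖ ≤
      Real.exp ((Real.log (2 * ‖γ‖) + Real.log ‖q‖ / 2) * i - Real.log ‖q‖ * (i : ℝ) ^ 2 / 2) := by
  have hγ' : 0 < ‖γ‖ := norm_pos_iff.2 hγ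
  have hq0 : 0 < ‖q‖ := by linarith
  have hfac : ∀ s < i, ‖γ / q ^ k - γ / q ^ s‖ ≤
      Real.exp (Real.log (2 * ‖γ‖) - s * Real.log ‖q‖) := by
    intro s hs
    rw [Real.exp_sub, Real.exp_nat_mul, Real.exp_log hq0, Real.exp_log (by positivity)]
    refine (norm_sub_le _ _).trans ?_
    rw [norm_div, norm_div, norm_pow, norm_pow, two_mul, add_div]
    gcongr
    · exact hq.le
    · omega
  rw [nodePoly, eval_prod, norm_prod]
  refine (Finset.prod_le_prod (fun _ _ => norm_nonneg _) fun s hs => ?_).trans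
    (le_of_eq ((Real.exp_sum (Finset.range i)
      fun s : ℕ => Real.log (2 * ‖γ‖) - s * Real.log ‖q‖).symm.trans ?_))
  · simpa using hfac s (Finset.mem_range.1 hs)
  · congr 1
    have := sum_range_quadratic (Real.log (2 * ‖γ‖)) (-Real.log ‖q‖) 0 i
    rw [Finset.sum_congr rfl fun (s : ℕ) _ => show Real.log (2 * ‖γ‖) - s * Real.log ‖q‖ =
      Real.log (2 * ‖γ‖) + -Real.log ‖q‖ * s + 0 * (s : ℝ) ^ 2 by ring, this]
    ring

theorem exists_norm_hankelDet_tschSeq_le_of_eq_tsum (hq : 1 < ‖q‖) (hα : α ≠ 0) {d : ℂ}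
    (hd : d ≠ 0) : ∃ B : ℝ, ∀ n : ℕ,
    ‖hankelDet (tschSeq q d (d ^ 2) (d * α) (d * ∑' k, tschTerm q α k)) n‖ ≤
      Real.exp (-(1 / 2 * Real.log ‖q‖ * (n : ℝ) ^ 3) + B * (n : ℝ) ^ 2) := by
  have hγ : d * α ≠ 0 := mul_ne_zero hd hα
  have hl : 0 < Real.log ‖q‖ := Real.log_pos hq
  set l := Real.log ‖q‖ with hl_def
  set c := |Real.log ‖α‖| with hc
  have hc0 : 0 ≤ c := abs_nonneg _
  set S := ∑' k : ℕ, Real.exp (-(k : ℝ)) with hS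
  have hS0 : 0 < S := summable_exp_neg_natCast.tsum_pos (fun k => (Real.exp_pos _).le) 0
    (Real.exp_pos _)
  have hd0 : 0 < ‖d‖ := norm_pos_iff.2 hd
  set κ := Real.log (‖d‖ * S) + (c + 1) ^ 2 / (2 * l) with hκ
  set e := Real.log (2 * ‖d * α‖) + l / 2 with he
  obtain ⟨B, hB⟩ := exists_norm_det_le_exp (κ / 2) (c + 1 + e) (-(3 / 4 * l))
  refine ⟨B, fun n => ?_⟩
  have hdet := det_seqFunctional_mul (tschSeq q d (d ^ 2) (d * α) (d * ∑' k, tschTerm q α k)) n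
    (nodePoly q (d * α)) (nodePoly q (d * α)) (nodePoly_monic _ _) (natDegree_nodePoly _ _)
    (nodePoly_monic _ _) (natDegree_nodePoly _ _)
  rw [hankelDet, ← hdet]
  refine (hB n _ fun i j => ?_).trans (le_of_eq (by ring_nf))
  have hsum := hasSum_seqFunctional (A := fun k => d * tschTerm q α k)
    (z := fun k => d * α / q ^ k) (Z := ‖d * α‖)
    (by simpa only [norm_mul] using (summable_norm_tschTerm hq hα).mul_left ‖d‖)
    (fun k => by
      rw [norm_div, norm_pow]
      exact div_le_self (norm_nonneg _) (one_le_pow₀ hq.le))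
    (tschSeq_eq_tsum hq hα d) (nodePoly q (d * α) i * nodePoly q (d * α) j)
  rw [Matrix.of_apply]
  have hmain := hsum.norm_le_of_bounded (summable_exp_neg_natCast.hasSum.mul_left
    (‖d‖ * Real.exp ((c + 1) ^ 2 / (2 * l) + (c + 1 + e) * ((i : ℕ) + (j : ℕ)) -
      3 / 4 * l * (((i : ℕ) : ℝ) ^ 2 + ((j : ℕ) : ℝ) ^ 2)))) fun k => by
    rw [eval_mul]
    rcases lt_or_ge k i with hi | hi
    · rw [eval_nodePoly_eq_zero _ _ hi, zero_mul, mul_zero, norm_zero]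
      positivity
    rcases lt_or_ge k j with hj | hj
    · rw [eval_nodePoly_eq_zero _ _ hj, mul_zero, mul_zero, norm_zero]
      positivity
    have hi' := norm_eval_nodePoly_le hq hγ hi
    have hj' := norm_eval_nodePoly_le hq hγ hj
    have hk := norm_tschTerm_le hq hα k
    rw [norm_mul, norm_mul, norm_mul, mul_assoc, mul_assoc]
    refine mul_le_mul_of_nonneg_left ?_ hd0.le
    refine (mul_le_mul hk (mul_le_mul hi' hj' (norm_nonneg _) (Real.exp_pos _).le)
      (by positivity) (Real.exp_pos _).le).trans ?_
    rw [← Real.exp_add, ← Real.exp_add, ← Real.exp_add, Real.exp_le_exp, ← hl_def, ← hc, ← he]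
    obtain ⟨m, hmk, hm0, hm1, hm2⟩ : ∃ m : ℝ, m ≤ k ∧ 0 ≤ m ∧ m ≤ (i : ℕ) + (j : ℕ) ∧
        ((i : ℕ) : ℝ) ^ 2 + ((j : ℕ) : ℝ) ^ 2 ≤ 2 * m ^ 2 := by
      have hi0 : (0 : ℝ) ≤ (i : ℕ) := Nat.cast_nonneg _
      have hj0 : (0 : ℝ) ≤ (j : ℕ) := Nat.cast_nonneg _
      rcases le_total ((i : ℕ) : ℝ) (j : ℕ) with h | h
      · exact ⟨(j : ℕ), by exact_mod_cast hj, hj0, by linarith, by nlinarith⟩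
      · exact ⟨(i : ℕ), by exact_mod_cast hi, hi0, by linarith, by nlinarith⟩
    have h1 := sub_sq_le_of_le (c := c) hl hm0 hmk
    have h2 := mul_le_mul_of_nonneg_left hm1 (by linarith : 0 ≤ c + 1)
    have h3 := mul_le_mul_of_nonneg_left hm2 hl.le
    linarith
  refine hmain.trans (le_of_eq ?_)
  rw [mul_right_comm, ← Real.exp_log (mul_pos hd0 hS0), ← Real.exp_add]
  congr 1
  rw [hκ]
  ring

end Decay

section NumberField

open Polynomial

theorem exists_one_le_norm_mul_norm {K : Type*} [Field K] [NumberField K]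
    (h : Module.finrank ℚ K ≤ 2) (φ₀ : K →ₐ[ℚ] ℂ) {x : NumberField.RingOfIntegers K} (hx : x ≠ 0) :
    ∃ φ : K →ₐ[ℚ] ℂ, 1 ≤ ‖φ₀ x‖ * ‖φ x‖ := by
  classical
  have hnorm : (1 : ℝ) ≤ ∏ φ : K →ₐ[ℚ] ℂ, ‖φ x‖ := by
    rw [← norm_prod, ← Algebra.norm_eq_prod_embeddings, ← Algebra.coe_norm_int,
      map_intCast, Complex.norm_intCast]
    exact_mod_cast Int.one_le_abs (Algebra.norm_ne_zero_iff.2 hx)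
  rw [← Finset.mul_prod_erase _ _ (Finset.mem_univ φ₀)] at hnorm
  have hcard : (Finset.univ.erase φ₀).card ≤ 1 := by
    rw [Finset.card_erase_of_mem (Finset.mem_univ _), Finset.card_univ, AlgHom.card]
    omega
  rcases Nat.le_one_iff_eq_zero_or_eq_one.1 hcard with h0 | h1
  · rw [Finset.card_eq_zero.1 h0, Finset.prod_empty, mul_one] at hnorm
    exact ⟨φ₀, one_le_mul_of_one_le_of_one_le hnorm hnorm⟩
  · obtain ⟨φ, hφ⟩ := Finset.card_eq_one.1 h1
    rw [hφ, Finset.prod_singleton] at hnorm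
    exact ⟨φ, hnorm⟩

theorem exists_int_mul_isIntegral {K : Type*} [Field K] [NumberField K] (x y : K) :
    ∃ d : ℤ, d ≠ 0 ∧ IsIntegral ℤ ((d : K) * x) ∧ IsIntegral ℤ ((d : K) * y) := by
  have hx : IsAlgebraic ℤ x := (IsFractionRing.isAlgebraic_iff ℤ ℚ K).2 (Algebra.IsAlgebraic.isAlgebraic x)
  have hy : IsAlgebraic ℤ y := (IsFractionRing.isAlgebraic_iff ℤ ℚ K).2 (Algebra.IsAlgebraic.isAlgebraic y)
  obtain ⟨c, hc, hcx⟩ := hx.exists_integral_multiple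
  obtain ⟨d, hd, hdy⟩ := hy.exists_integral_multiple
  rw [zsmul_eq_mul] at hcx hdy
  refine ⟨c * d, mul_ne_zero hc hd, ?_, ?_⟩
  · convert! (isIntegral_algebraMap (R := ℤ) (A := K) (x := d)).mul hcx using 1
    simp
    ring
  · convert! (isIntegral_algebraMap (R := ℤ) (A := K) (x := c)).mul hdy using 1
    simp
    ring

end NumberField

section Specialization

open Polynomial

variable {R : Type*} [CommRing R]

theorem map_hankelDet {A B : Type*} [CommRing A] [CommRing B] (f : A →+* B) (w : ℕ → A) (n : ℕ) :
    f (hankelDet w n) = hankelDet (fun i => f (w i)) n := by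
  rw [hankelDet, RingHom.map_det]
  rfl

theorem eval₂_hankelDet_tschSeq (f : R →+* ℂ) (q : ℂ) (d c a b : R) (n : ℕ) :
    (hankelDet (tschSeq X (C d) (C c) (C a) (C b)) n).eval₂ f q =
      hankelDet (tschSeq q (f d) (f c) (f a) (f b)) n := by
  rw [← coe_eval₂RingHom, map_hankelDet]
  simp only [map_tschSeq, coe_eval₂RingHom, eval₂_X, eval₂_C]

theorem map_cyclDivisor {A B : Type*} [CommRing A] [CommRing B] (f : A →+* B) (S : Finset ℕ)
    (n : ℕ) : (cyclDivisor A S n).map f = cyclDivisor B S n := by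
  simp [cyclDivisor, Polynomial.map_prod]

/-- Clearing the denominators of the value at `ρ / σ` of a cofactor of `cyclDivisor`. -/
theorem map_eval_scaleRoots_mul (f : R →+* ℂ) {q : ℂ} {ρ σ : ℤ} (hq : (σ : ℂ) * q = ρ)
    {D P : R[X]} {S : Finset ℕ} {n : ℕ} (hD : D = cyclDivisor R S n * P) :
    f ((scaleRoots P (σ : R)).eval (ρ : R)) * (cyclDivisor ℂ S n).eval q =
      (σ : ℂ) ^ P.natDegree * D.eval₂ f q := by
  have h1 : f ((scaleRoots P (σ : R)).eval (ρ : R)) =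
      (σ : ℂ) ^ P.natDegree * P.eval₂ f q := by
    rw [← eval₂_hom, map_intCast, ← hq, ← map_intCast f σ, scaleRoots_eval₂_mul]
  rw [h1, hD, eval₂_mul, ← map_cyclDivisor f, eval_map]
  ring

theorem log_norm_map_eval_scaleRoots_le (f : R →+* ℂ) {q : ℂ} {ρ σ : ℤ} (hσ : σ ≠ 0)
    (hq : (σ : ℂ) * q = ρ) {D P : R[X]} {S : Finset ℕ} {n : ℕ} (hD : D = cyclDivisor R S n * P)
    (hΔ : (cyclDivisor ℂ S n).eval q ≠ 0) {E : ℝ} (hE : ‖D.eval₂ f q‖ ≤ Real.exp E)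
    (h0 : f ((scaleRoots P (σ : R)).eval (ρ : R)) ≠ 0) :
    Real.log ‖f ((scaleRoots P (σ : R)).eval (ρ : R))‖ + Real.log ‖(cyclDivisor ℂ S n).eval q‖ ≤
      P.natDegree * Real.log |(σ : ℝ)| + E := by
  have hσ0 : 0 < |(σ : ℝ)| := abs_pos.2 (Int.cast_ne_zero.2 hσ)
  have h := congrArg norm (map_eval_scaleRoots_mul f hq hD)
  rw [norm_mul, norm_mul, norm_pow, Complex.norm_intCast] at h
  rw [← Real.log_mul (norm_ne_zero_iff.2 h0) (norm_ne_zero_iff.2 hΔ), h, ← Real.log_pow,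
    ← Real.log_exp E, ← Real.log_mul (pow_pos hσ0 _).ne' (Real.exp_pos _).ne']
  refine Real.log_le_log (h ▸ mul_pos (norm_pos_iff.2 h0) (norm_pos_iff.2 hΔ)) ?_
  gcongr

theorem natDegree_cofactor_le [IsDomain R] {d c a b : R} {P : R[X]} {S : Finset ℕ} {n : ℕ}
    (hP : P ≠ 0)
    (hD : hankelDet (tschSeq X (C d) (C c) (C a) (C b)) n = cyclDivisor R S n * P) :
    ((cyclDivisor R S n).natDegree : ℝ) + P.natDegree ≤ 2 / 3 * (n : ℝ) ^ 3 := by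
  have h := natDegree_det_tschSeq_le d c a b n
  rw [← hankelDet, hD, natDegree_mul (cyclDivisor_monic R S n).ne_zero hP] at h
  have h' : (3 : ℝ) * ((cyclDivisor R S n).natDegree + P.natDegree) ≤ 2 * (n : ℝ) ^ 3 := by
    exact_mod_cast h
  linarith

end Specialization

section Main

open Polynomial

theorem not_exists_numberField {ρ σ : ℤ} (hσ : σ ≠ 0) (hρσ : |σ| < |ρ|) {q : ℂ}
    (hq : q = (ρ : ℂ) / (σ : ℂ)) {α : ℂ} (hα : α ≠ 0) {L : ℝ}
    (hL : L = ∑' n : ℕ, Real.sin (2 * Real.pi * (n + 1) / 3) / ((n : ℝ) + 1) ^ 2)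
    (hγ : Real.log |(ρ : ℝ)| >
      126 * Real.pi ^ 2 / (47 * Real.pi ^ 2 - 72 * Real.sqrt 3 * L) * Real.log |(σ : ℝ)|)
    {K : Type} [Field K] [NumberField K] (hdeg : Module.finrank ℚ K ≤ 2) (φ₀ : K →ₐ[ℚ] ℂ) {x y : K}
    (hx : φ₀ x = α) (hy : φ₀ y = ∑' k, tschTerm q α k) : False := by
  obtain ⟨κ, S, hκ0, hκ, hS, hpar⟩ := exists_parameters hL hγ
  set u := Real.log |(σ : ℝ)| with hu
  set v := Real.log |(ρ : ℝ)| with hv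
  have hσ1 : (1 : ℝ) ≤ |(σ : ℝ)| := by exact_mod_cast Int.one_le_abs hσ
  have hρσ' : |(σ : ℝ)| < |(ρ : ℝ)| := by exact_mod_cast hρσ
  have hσ0 : (0 : ℝ) < |(σ : ℝ)| := by linarith
  have hqnorm : ‖q‖ = |(ρ : ℝ)| / |(σ : ℝ)| := by
    rw [hq, norm_div, Complex.norm_intCast, Complex.norm_intCast]
  have hq1 : 1 < ‖q‖ := by rwa [hqnorm, one_lt_div hσ0]
  have hlog : Real.log ‖q‖ = v - u := by
    rw [hqnorm, Real.log_div (by linarith) hσ0.ne']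
  have hσq : (σ : ℂ) * q = ρ := by
    rw [hq, mul_div_cancel₀ _ (Int.cast_ne_zero.2 hσ)]
  obtain ⟨d, hd, ha, hb⟩ := exists_int_mul_isIntegral x y
  let R := NumberField.RingOfIntegers K
  let a : R := ⟨_, ha⟩
  let b : R := ⟨_, hb⟩
  let f : (K →ₐ[ℚ] ℂ) → R →+* ℂ := fun φ => (φ : K →+* ℂ).comp (algebraMap R K)
  have hinj : ∀ φ, Function.Injective (f φ) := fun φ =>
    (RingHom.injective (φ : K →+* ℂ)).comp NumberField.RingOfIntegers.coe_injective
  have hfd : ∀ φ, f φ (d : R) = d := fun φ => map_intCast _ _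
  have hfa : f φ₀ a = d * α := by
    rw [← hx, ← map_intCast φ₀ d, ← map_mul]
    rfl
  have hfb : f φ₀ b = d * ∑' k, tschTerm q α k := by
    rw [← hy, ← map_intCast φ₀ d, ← map_mul]
    rfl
  let D : ℕ → R[X] := fun n =>
    hankelDet (tschSeq X (C (d : R)) (C ((d : R) ^ 2)) (C a) (C b)) n
  have hDval : ∀ n, (D n).eval₂ (f φ₀) q =
      hankelDet (tschSeq q d ((d : ℂ) ^ 2) (d * α) (d * ∑' k, tschTerm q α k)) n := fun n => by
    rw [eval₂_hankelDet_tschSeq, map_pow, hfd, hfa, hfb]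
  have hdC : (d : ℂ) ≠ 0 := Int.cast_ne_zero.2 hd
  obtain ⟨B₁, hB₁⟩ := exists_le_natDegree_cyclDivisor hκ0 hκ fun s hs => (hS s hs).1
  obtain ⟨B₂, hB₂⟩ := exists_le_log_norm_cyclDivisor hq1 S
  obtain ⟨B₃, hB₃⟩ := exists_norm_hankelDet_tschSeq_le_of_eq_tsum hq1 hα hdC
  choose B hB using fun φ => exists_norm_hankelDet_tschSeq_le hq1 (f φ d) (f φ ((d : R) ^ 2))
    (f φ a) (f φ b)
  obtain ⟨B₄, hB₄⟩ := Finite.exists_le B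
  set c := 5 / 24 + κ / 3 * ∑ s ∈ S, 1 / (s : ℝ) ^ 2 with hc
  set ε := (2 * c - 1 / 6) * v - 7 / 6 * u with hε
  have hε0 : 0 < ε := sub_pos.2 hpar
  obtain ⟨N, hN⟩ := exists_nat_gt ((2 * B₁ * v + 2 * B₂ + B₃ + B₄) / ε)
  obtain ⟨n, hn, hn0⟩ := exists_hankelDet_tschSeq_ne_zero hq1 hα hdC (N + 1)
  obtain ⟨P, hP⟩ : cyclDivisor R S n ∣ D n := cyclDivisor_dvd_det hS _ _ _ _ n
  obtain ⟨hΔ0, hΔ⟩ := hB₂ n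
  rw [← hDval] at hn0
  have hP0 : P ≠ 0 := fun h => hn0 (by rw [hP, h, mul_zero, eval₂_zero])
  let β : R := (scaleRoots P (σ : R)).eval (ρ : R)
  have hβ0 : β ≠ 0 := fun h => by
    have h1 := map_eval_scaleRoots_mul (f φ₀) hσq hP
    change f φ₀ β * _ = _ at h1
    rw [h, map_zero, zero_mul] at h1
    exact mul_ne_zero (pow_ne_zero _ (Int.cast_ne_zero.2 hσ)) hn0 h1.symm
  have hfβ : ∀ φ, f φ β ≠ 0 := fun φ => (map_ne_zero_iff _ (hinj φ)).2 hβ0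
  obtain ⟨φ, hφ⟩ := exists_one_le_norm_mul_norm hdeg φ₀ hβ0
  have hφ' : 0 ≤ Real.log ‖f φ₀ β‖ + Real.log ‖f φ β‖ := by
    rw [← Real.log_mul (norm_ne_zero_iff.2 (hfβ φ₀)) (norm_ne_zero_iff.2 (hfβ φ))]
    exact Real.log_nonneg hφ
  have h1 := log_norm_map_eval_scaleRoots_le (f φ₀) hσ hσq hP hΔ0
    (by rw [hDval]; exact hB₃ n) (hfβ _)
  have h2 := log_norm_map_eval_scaleRoots_le (f φ) hσ hσq hP hΔ0
    (by rw [eval₂_hankelDet_tschSeq]; exact hB φ n) (hfβ _)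
  rw [← hu] at h1 h2
  have h3 := natDegree_cofactor_le hP0 hP
  have h4 := hB₁ R n
  have h5 := hB₁ ℂ n
  rw [hlog] at h1 h2 hΔ
  have hu0 : 0 ≤ u := Real.log_nonneg hσ1
  have hvu : 0 ≤ v - u := hlog ▸ (Real.log_pos hq1).le
  have h6 := mul_le_mul_of_nonneg_right (by linarith :
    (P.natDegree : ℝ) ≤ 2 / 3 * (n : ℝ) ^ 3 - (c * (n : ℝ) ^ 3 - B₁ * (n : ℝ) ^ 2)) hu0
  have h7 := mul_le_mul_of_nonneg_right h5 hvu
  have h8 := mul_le_mul_of_nonneg_right (hB₄ φ) (sq_nonneg (n : ℝ))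
  have h9 : ε * (n : ℝ) ^ 3 ≤ (2 * B₁ * v + 2 * B₂ + B₃ + B₄) * (n : ℝ) ^ 2 := by
    rw [hε]
    linarith
  have hnN : (N : ℝ) + 1 ≤ n := by exact_mod_cast hn
  have hN0 : (0 : ℝ) ≤ N := Nat.cast_nonneg N
  rw [div_lt_iff₀ hε0] at hN
  have h10 : (2 * B₁ * v + 2 * B₂ + B₃ + B₄) < n * ε := by nlinarith
  have h11 := mul_lt_mul_of_pos_right h10 (pow_pos (by linarith : (0 : ℝ) < n) 2)
  linarith

end Main

theorem stmt_1 (ρ σ : ℤ) (hcop : IsCoprime ρ σ) (hσ : σ ≠ 0) (hρσ : |σ| < |ρ|)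
    (q : ℂ) (hq : q = (ρ : ℂ) / (σ : ℂ))
    (α : ℂ) (hα : α ≠ 0)
    (μ : ℂ) (hμ : μ = ∑' n : ℕ, α ^ n / q ^ (n * (n + 1) / 2))
    (L : ℝ) (hL : L = ∑' n : ℕ, Real.sin (2 * Real.pi * (n + 1) / 3) / ((n : ℝ) + 1) ^ 2)
    (hγ : Real.log |(ρ : ℝ)| >
      126 * Real.pi ^ 2 / (47 * Real.pi ^ 2 - 72 * Real.sqrt 3 * L) * Real.log |(σ : ℝ)|) :
    ¬ ∃ K : IntermediateField ℚ ℂ, FiniteDimensional ℚ K ∧ Module.finrank ℚ K ≤ 2 ∧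
      α ∈ K ∧ μ ∈ K := by
  rintro ⟨K, hfin, hdeg, hαK, hμK⟩
  have : NumberField K := ⟨⟩
  exact not_exists_numberField hσ hρσ hq hα hL hγ (K := K) hdeg (algebraMap K ℂ).toRatAlgHom
    (x := ⟨α, hαK⟩) (y := ⟨μ, hμK⟩) rfl hμ
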